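/- For jointly Gaussian scalar random variables X and Y with correlation coefficient ρ ∈ [0,1) and any γ ≥ 0, the relaxed Wyner's common information equals C_γ(X;Y) = (1/2)·log⁺ [ (1+ρ)(1 − √(1 − e^{−2γ})) / ( (1−ρ)(1 + √(1 − e^{−2γ})) ) ], where log⁺(t) = max{log t, 0} and logarithms are natural. -/

import Mathlib

open MeasureTheory ProbabilityTheory Real Classical
open scoped ENNReal NNReal

noncomputable section

/-- Kullback–Leibler divergence `D(μ‖ν) = ∫ log(dμ/dν) dμ`, with value `⊤` when `μ` is not
absolutely continuous w.r.t. `ν` or the log-likelihood ratio is not integrable. -/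
noncomputable def klDivE {E : Type*} [MeasurableSpace E] (μ ν : Measure E) : EReal :=
  if μ ≪ ν ∧ Integrable (llr μ ν) μ then ((∫ x, llr μ ν x ∂μ : ℝ) : EReal) else ⊤

/-- Mutual information of a pair with joint law `ρ`: the KL divergence between `ρ` and the
product of its marginals. -/
noncomputable def miE {E F : Type*} [MeasurableSpace E] [MeasurableSpace F]
    (ρ : Measure (E × F)) : EReal :=
  klDivE ρ ((ρ.map Prod.fst).prod (ρ.map Prod.snd))

end

section

open InformationTheory Filter Topology Set

section MutualInformation

variable {E F G E' F' : Type*} [MeasurableSpace E] [MeasurableSpace F] [MeasurableSpace G]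
  [MeasurableSpace E'] [MeasurableSpace F']

/-- Mutual information of a pair with joint law `σ`, as an extended nonnegative real. -/
noncomputable def mutInfo (σ : Measure (E × F)) : ℝ≥0∞ :=
  klDiv σ ((σ.map Prod.fst).prod (σ.map Prod.snd))

lemma klDivE_eq_klDiv (μ ν : Measure E) [IsProbabilityMeasure μ] [IsProbabilityMeasure ν] :
    klDivE μ ν = ((klDiv μ ν : ℝ≥0∞) : EReal) := by
  unfold klDivE
  split_ifs with h
  · rw [klDiv_of_ac_of_integrable h.1 h.2, EReal.coe_ennreal_ofReal,
      max_eq_left (integral_llr_add_sub_measure_univ_nonneg h.1 h.2)]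
    simp
  · rw [← klDiv_ne_top_iff, not_ne_iff] at h
    rw [h, EReal.coe_ennreal_top]

lemma isProbabilityMeasure_map_fst (σ : Measure (E × F)) [IsProbabilityMeasure σ] :
    IsProbabilityMeasure (σ.map Prod.fst) :=
  Measure.isProbabilityMeasure_map measurable_fst.aemeasurable

lemma isProbabilityMeasure_map_snd (σ : Measure (E × F)) [IsProbabilityMeasure σ] :
    IsProbabilityMeasure (σ.map Prod.snd) :=
  Measure.isProbabilityMeasure_map measurable_snd.aemeasurable

lemma miE_eq_mutInfo (σ : Measure (E × F)) [IsProbabilityMeasure σ] :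
    miE σ = ((mutInfo σ : ℝ≥0∞) : EReal) := by
  have := isProbabilityMeasure_map_fst σ
  have := isProbabilityMeasure_map_snd σ
  exact klDivE_eq_klDiv _ _

lemma klDiv_map_measurableEquiv (e : E ≃ᵐ F) (μ ν : Measure E)
    [IsFiniteMeasure μ] [IsFiniteMeasure ν] :
    klDiv (μ.map e) (ν.map e) = klDiv μ ν := by
  refine le_antisymm (klDiv_map_le _ _ e.measurable) ?_
  have h := klDiv_map_le (μ.map e) (ν.map e) e.symm.measurable
  simpa [Measure.map_map e.symm.measurable e.measurable] using h

lemma mutInfo_map_prodMap_le (σ : Measure (E × F)) [IsProbabilityMeasure σ]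
    {f : E → E'} {g : F → F'} (hf : Measurable f) (hg : Measurable g) :
    mutInfo (σ.map (Prod.map f g)) ≤ mutInfo σ := by
  have := isProbabilityMeasure_map_fst σ
  have := isProbabilityMeasure_map_snd σ
  have h := klDiv_map_le σ ((σ.map Prod.fst).prod (σ.map Prod.snd)) (hf.prodMap hg)
  rw [← Measure.map_prod_map _ _ hf hg, Measure.map_map hf measurable_fst,
    Measure.map_map hg measurable_snd] at h
  rw [mutInfo, Measure.map_map measurable_fst (hf.prodMap hg),
    Measure.map_map measurable_snd (hf.prodMap hg)]
  exact h

lemma mutInfo_map_measurableEquiv (σ : Measure (E × F)) [IsProbabilityMeasure σ]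
    (e : E ≃ᵐ E') (f : F ≃ᵐ F') :
    mutInfo (σ.map (Prod.map e f)) = mutInfo σ := by
  refine le_antisymm (mutInfo_map_prodMap_le σ e.measurable f.measurable) ?_
  have : IsProbabilityMeasure (σ.map (Prod.map e f)) :=
    Measure.isProbabilityMeasure_map (e.measurable.prodMap f.measurable).aemeasurable
  have h := mutInfo_map_prodMap_le (σ.map (Prod.map e f)) e.symm.measurable f.symm.measurable
  rw [Measure.map_map (e.symm.measurable.prodMap f.symm.measurable)
    (e.measurable.prodMap f.measurable)] at h
  have hid : Prod.map e.symm f.symm ∘ Prod.map e f = id := by ext x <;> simp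
  rwa [hid, Measure.map_id] at h

lemma mutInfo_map_swap (σ : Measure (E × F)) [IsProbabilityMeasure σ] :
    mutInfo (σ.map Prod.swap) = mutInfo σ := by
  have := isProbabilityMeasure_map_fst σ
  have := isProbabilityMeasure_map_snd σ
  rw [mutInfo, mutInfo, Measure.map_map measurable_fst measurable_swap,
    Measure.map_map measurable_snd measurable_swap]
  have h := klDiv_map_measurableEquiv (MeasurableEquiv.prodComm (α := E) (β := F)) σ
    ((σ.map Prod.fst).prod (σ.map Prod.snd))
  rw [← h]
  congr 1
  exact (Measure.prod_swap (μ := σ.map Prod.fst) (ν := σ.map Prod.snd)).symm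

lemma klDiv_prod_eq_add [StandardBorelSpace F] [Nonempty F] (σ : Measure (E × F))
    [IsProbabilityMeasure σ] (α : Measure E) (β : Measure F)
    [IsProbabilityMeasure α] [IsProbabilityMeasure β] :
    klDiv σ (α.prod β) = klDiv (σ.map Prod.fst) α + klDiv σ ((σ.map Prod.fst).prod β) := by
  have h := klDiv_compProd_eq_add σ.fst α σ.condKernel (Kernel.const E β)
  rwa [σ.disintegrate, Measure.compProd_const, Measure.compProd_const] at h

lemma klDiv_prod_prod [StandardBorelSpace F] [Nonempty F] (α α' : Measure E) (β β' : Measure F)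
    [IsProbabilityMeasure α] [IsProbabilityMeasure β]
    [IsProbabilityMeasure α'] [IsProbabilityMeasure β'] :
    klDiv (α.prod β) (α'.prod β') = klDiv α α' + klDiv β β' := by
  have h := klDiv_compProd_left β β' (Kernel.const F α)
  rw [Measure.compProd_const, Measure.compProd_const] at h
  rw [klDiv_prod_eq_add, Measure.map_fst_prod, measure_univ, one_smul, ← h,
    ← Measure.prod_swap (μ := β), ← Measure.prod_swap (μ := β')]
  congr 1
  exact klDiv_map_measurableEquiv (MeasurableEquiv.prodComm (α := F) (β := E)) _ _

/-- Chain rule: `I(X;Y) + I(X,Y;W) = I(Y;W) + I(X;Y,W)`. -/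
lemma mutInfo_chain [StandardBorelSpace E] [Nonempty E] [StandardBorelSpace F] [Nonempty F]
    [StandardBorelSpace G] [Nonempty G] (ν : Measure ((E × F) × G)) [IsProbabilityMeasure ν] :
    mutInfo (ν.map Prod.fst) + mutInfo ν =
      mutInfo (ν.map fun p => (p.1.2, p.2)) + mutInfo (ν.map fun p => (p.1.1, (p.1.2, p.2))) := by
  have m1 : Measurable fun p : (E × F) × G => p.1.1 := by fun_prop
  have m2 : Measurable fun p : (E × F) × G => p.1.2 := by fun_prop
  have m3 : Measurable fun p : (E × F) × G => p.2 := by fun_prop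
  have m23 : Measurable fun p : (E × F) × G => (p.1.2, p.2) := by fun_prop
  have m231 : Measurable fun p : (E × F) × G => ((p.1.2, p.2), p.1.1) := by fun_prop
  have m1_23 : Measurable fun p : (E × F) × G => (p.1.1, (p.1.2, p.2)) := by fun_prop
  have : IsProbabilityMeasure (ν.map fun p => p.1.1) :=
    Measure.isProbabilityMeasure_map m1.aemeasurable
  have : IsProbabilityMeasure (ν.map fun p => p.1.2) :=
    Measure.isProbabilityMeasure_map m2.aemeasurable
  have : IsProbabilityMeasure (ν.map fun p => p.2) :=
    Measure.isProbabilityMeasure_map m3.aemeasurable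
  have : IsProbabilityMeasure (ν.map fun p => ((p.1.2, p.2), p.1.1)) :=
    Measure.isProbabilityMeasure_map m231.aemeasurable
  have : IsProbabilityMeasure (ν.map fun p => (p.1.1, (p.1.2, p.2))) :=
    Measure.isProbabilityMeasure_map m1_23.aemeasurable
  set α := ν.map fun p => p.1.1
  set β := ν.map fun p => p.1.2
  set γ := ν.map fun p => p.2
  have hl : mutInfo (ν.map Prod.fst) + mutInfo ν = klDiv ν ((α.prod β).prod γ) := by
    rw [klDiv_prod_eq_add, mutInfo, mutInfo, Measure.map_map measurable_fst measurable_fst,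
      Measure.map_map measurable_snd measurable_fst]
    rfl
  let e : (E × F) × G ≃ᵐ (F × G) × E :=
    MeasurableEquiv.prodAssoc.trans MeasurableEquiv.prodComm
  have he : (⇑e : (E × F) × G → (F × G) × E) = fun p => ((p.1.2, p.2), p.1.1) := rfl
  have hmap : ((α.prod β).prod γ).map e = (β.prod γ).prod α := by
    rw [← Measure.prod_swap (μ := α) (ν := β.prod γ), ← Measure.prodAssoc_prod]
    exact (Measure.map_map (μ := (α.prod β).prod γ) measurable_swap
      MeasurableEquiv.prodAssoc.measurable).symm
  have : IsProbabilityMeasure (ν.map e) :=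
    Measure.isProbabilityMeasure_map e.measurable.aemeasurable
  rw [hl, ← klDiv_map_measurableEquiv e, hmap, klDiv_prod_eq_add, he,
    Measure.map_map measurable_fst m231, ← mutInfo_map_swap (ν.map fun p => (p.1.1, (p.1.2, p.2))),
    Measure.map_map measurable_swap m1_23, mutInfo, mutInfo,
    Measure.map_map measurable_fst m23, Measure.map_map measurable_snd m23]
  have hs : (Prod.swap ∘ fun p : (E × F) × G => (p.1.1, (p.1.2, p.2)))
    = fun p => ((p.1.2, p.2), p.1.1) := rfl
  rw [hs, Measure.map_map measurable_fst m231, Measure.map_map measurable_snd m231]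
  rfl

end MutualInformation

section GaussianDensities

lemma klDiv_withDensity_exp {E : Type*} [MeasurableSpace E] {μ ν : Measure E}
    [IsProbabilityMeasure μ] [IsProbabilityMeasure ν] {q : E → ℝ} (hq : Measurable q)
    (hμ : μ = ν.withDensity fun x => ENNReal.ofReal (exp (q x))) (hint : Integrable q μ) :
    klDiv μ ν = ENNReal.ofReal (∫ x, q x ∂μ) := by
  have hac : μ ≪ ν := by rw [hμ]; exact withDensity_absolutelyContinuous _ _
  have hr : llr μ ν =ᵐ[μ] q := by
    have h : μ.rnDeriv ν =ᵐ[ν] fun x => ENNReal.ofReal (exp (q x)) := by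
      conv_lhs => rw [hμ]
      exact Measure.rnDeriv_withDensity _ (by fun_prop)
    filter_upwards [hac h] with x hx
    rw [llr, hx, ENNReal.toReal_ofReal (exp_pos _).le, Real.log_exp]
  rw [klDiv_of_ac_of_integrable hac (hint.congr hr.symm), integral_congr_ae hr]
  simp

lemma integrable_sq_gaussianReal (v : ℝ≥0) :
    Integrable (fun x => x ^ 2) (gaussianReal 0 v) := by
  simpa using (memLp_id_gaussianReal (μ := 0) (v := v) 2).integrable_sq

lemma integral_sq_gaussianReal (v : ℝ≥0) : ∫ x, x ^ 2 ∂(gaussianReal 0 v) = v := by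
  have h := variance_fun_id_gaussianReal (μ := 0) (v := v)
  rw [variance_eq_integral (by fun_prop)] at h
  simpa using h

/-- The logarithm of the density of `N(0, v)` with respect to `N(0, w)`. -/
noncomputable def gaussianLogRatio (v w : ℝ) (x : ℝ) : ℝ :=
  1 / 2 * Real.log (w / v) + (1 / (2 * w) - 1 / (2 * v)) * x ^ 2

@[fun_prop]
lemma measurable_gaussianLogRatio (v w : ℝ) : Measurable (gaussianLogRatio v w) := by
  unfold gaussianLogRatio; fun_prop

lemma gaussianPDFReal_mul_exp_gaussianLogRatio {v w : ℝ≥0} (hv : v ≠ 0) (hw : w ≠ 0) (x : ℝ) :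
    gaussianPDFReal 0 w x * exp (gaussianLogRatio v w x) = gaussianPDFReal 0 v x := by
  have hv' : (0 : ℝ) < v := by positivity
  have hw' : (0 : ℝ) < w := by positivity
  have h1 : exp (1 / 2 * Real.log (w / v)) = √(w / v) := by
    rw [Real.sqrt_eq_rpow, Real.rpow_def_of_pos (by positivity), mul_comm]
  have h2 : (√(2 * π * w))⁻¹ * √(w / v) = (√(2 * π * v))⁻¹ := by
    rw [← Real.sqrt_inv, ← Real.sqrt_inv, ← Real.sqrt_mul (by positivity)]
    congr 1
    field_simp
  rw [gaussianLogRatio, exp_add, h1, gaussianPDFReal, gaussianPDFReal, ← h2]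
  rw [mul_mul_mul_comm, ← exp_add]
  congr 2
  field_simp
  ring

lemma gaussianReal_eq_withDensity_gaussianReal {v w : ℝ≥0} (hv : v ≠ 0) (hw : w ≠ 0) :
    gaussianReal 0 v =
      (gaussianReal 0 w).withDensity fun x => ENNReal.ofReal (exp (gaussianLogRatio v w x)) := by
  rw [gaussianReal_of_var_ne_zero _ hv, gaussianReal_of_var_ne_zero _ hw,
    ← withDensity_mul _ (measurable_gaussianPDF _ _) (by fun_prop)]
  congr 1
  ext x
  rw [Pi.mul_apply, gaussianPDF, gaussianPDF, ← ENNReal.ofReal_mul (gaussianPDFReal_nonneg _ _ _),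
    gaussianPDFReal_mul_exp_gaussianLogRatio hv hw]

lemma integrable_gaussianLogRatio (v w : ℝ) (u : ℝ≥0) :
    Integrable (gaussianLogRatio v w) (gaussianReal 0 u) :=
  (integrable_const _).add ((integrable_sq_gaussianReal u).const_mul _)

lemma integral_gaussianLogRatio (v w : ℝ) (u : ℝ≥0) :
    ∫ x, gaussianLogRatio v w x ∂(gaussianReal 0 u) =
      1 / 2 * Real.log (w / v) + (1 / (2 * w) - 1 / (2 * v)) * u := by
  unfold gaussianLogRatio
  rw [integral_add (integrable_const _) ((integrable_sq_gaussianReal u).const_mul _),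
    integral_const, integral_const_mul, integral_sq_gaussianReal]
  simp

lemma klDiv_gaussianReal {v w : ℝ≥0} (hv : v ≠ 0) (hw : w ≠ 0) :
    klDiv (gaussianReal 0 v) (gaussianReal 0 w) =
      ENNReal.ofReal (1 / 2 * Real.log (w / v) + (1 / (2 * w) - 1 / (2 * v)) * v) := by
  rw [klDiv_withDensity_exp (measurable_gaussianLogRatio v w)
    (gaussianReal_eq_withDensity_gaussianReal hv hw) (integrable_gaussianLogRatio _ _ _),
    integral_gaussianLogRatio]

end GaussianDensities

section BivariateGaussian

/-- Cramér–Wold: a law on the plane is determined by the laws of the linear combinations. -/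
lemma ext_of_map_linearCombination {μ ν : Measure (ℝ × ℝ)} [IsFiniteMeasure μ] [IsFiniteMeasure ν]
    (h : ∀ c d : ℝ, μ.map (fun p => c * p.1 + d * p.2) = ν.map fun p => c * p.1 + d * p.2) :
    μ = ν := by
  refine Measure.ext_of_charFunDual ?_
  ext L
  have hL : ⇑L = fun p : ℝ × ℝ => L (1, 0) * p.1 + L (0, 1) * p.2 := by
    ext p
    have hp : p = p.1 • ((1 : ℝ), (0 : ℝ)) + p.2 • ((0 : ℝ), (1 : ℝ)) := by ext <;> simp
    conv_lhs => rw [hp, map_add, map_smul, map_smul]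
    simp [mul_comm]
  rw [charFunDual_eq_charFun_map_one, charFunDual_eq_charFun_map_one, hL, h]

/-- The law of `(U + V, U - V)` with `U`, `V` independent centered Gaussians of variances
`a`, `b`. -/
noncomputable def rotGaussian (a b : ℝ≥0) : Measure (ℝ × ℝ) :=
  ((gaussianReal 0 a).prod (gaussianReal 0 b)).map fun p => (p.1 + p.2, p.1 - p.2)

lemma measurable_rot : Measurable fun p : ℝ × ℝ => (p.1 + p.2, p.1 - p.2) := by fun_prop

instance (a b : ℝ≥0) : IsProbabilityMeasure (rotGaussian a b) :=
  Measure.isProbabilityMeasure_map measurable_rot.aemeasurable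

lemma map_linearCombination_prod_gaussianReal (a b : ℝ≥0) (c d : ℝ) :
    ((gaussianReal 0 a).prod (gaussianReal 0 b)).map (fun p => c * p.1 + d * p.2) =
      gaussianReal 0 (c ^ 2 * a + d ^ 2 * b).toNNReal := by
  have hc := gaussianReal_map_const_mul (μ := 0) (v := a) c
  have hd := gaussianReal_map_const_mul (μ := 0) (v := b) d
  rw [mul_zero] at hc hd
  have h : (fun p : ℝ × ℝ => c * p.1 + d * p.2) =
      (fun p : ℝ × ℝ => p.1 + p.2) ∘ Prod.map (fun x => c * x) fun x => d * x := rfl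
  rw [h, ← Measure.map_map (by fun_prop) (by fun_prop), ← Measure.map_prod_map _ _ (by fun_prop)
    (by fun_prop), hc, hd]
  refine gaussianReal_conv_gaussianReal.trans ?_
  congr 1
  · simp
  · ext
    rw [Real.coe_toNNReal _ (by positivity)]
    rfl

lemma map_linearCombination_rotGaussian (a b : ℝ≥0) (c d : ℝ) :
    (rotGaussian a b).map (fun p => c * p.1 + d * p.2) =
      gaussianReal 0 ((c + d) ^ 2 * a + (c - d) ^ 2 * b).toNNReal := by
  rw [rotGaussian, Measure.map_map (by fun_prop) measurable_rot,
    ← map_linearCombination_prod_gaussianReal]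
  congr 1
  ext p
  simp only [Function.comp]
  ring

lemma map_fst_rotGaussian (a b : ℝ≥0) :
    (rotGaussian a b).map Prod.fst = gaussianReal 0 (a + b) := by
  have h := map_linearCombination_rotGaussian a b 1 0
  convert h using 2
  · ext p; simp
  · ext; simp

lemma map_snd_rotGaussian (a b : ℝ≥0) :
    (rotGaussian a b).map Prod.snd = gaussianReal 0 (a + b) := by
  have h := map_linearCombination_rotGaussian a b 0 1
  convert h using 2
  · ext p; simp
  · ext; simp

lemma rotGaussian_half_half :
    rotGaussian (1 / 2) (1 / 2) = (gaussianReal 0 1).prod (gaussianReal 0 1) := by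
  refine ext_of_map_linearCombination fun c d => ?_
  rw [map_linearCombination_rotGaussian, map_linearCombination_prod_gaussianReal]
  congr 2
  push_cast
  ring

/-- The linear isomorphism `(u, v) ↦ (u + v, u - v)`. -/
noncomputable def rotEquiv : ℝ × ℝ ≃ᵐ ℝ × ℝ where
  toFun p := (p.1 + p.2, p.1 - p.2)
  invFun p := ((p.1 + p.2) / 2, (p.1 - p.2) / 2)
  left_inv p := by ext <;> simp
  right_inv p := by ext <;> simp <;> ring
  measurable_toFun := measurable_rot
  measurable_invFun := by
    change Measurable fun p : ℝ × ℝ => ((p.1 + p.2) / 2, (p.1 - p.2) / 2)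
    fun_prop

lemma klDiv_rotGaussian (a b a' b' : ℝ≥0) :
    klDiv (rotGaussian a b) (rotGaussian a' b') =
      klDiv (gaussianReal 0 a) (gaussianReal 0 a') +
        klDiv (gaussianReal 0 b) (gaussianReal 0 b') := by
  rw [← klDiv_prod_prod]
  exact klDiv_map_measurableEquiv rotEquiv _ _

lemma mutInfo_rotGaussian {a b : ℝ≥0} (ha : a ≠ 0) (hb : b ≠ 0) (hab : a + b = 1) :
    mutInfo (rotGaussian a b) = ENNReal.ofReal (-(1 / 2) * Real.log (4 * a * b)) := by
  have ha' : (0 : ℝ) < a := by positivity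
  have hb' : (0 : ℝ) < b := by positivity
  have hab' : (a : ℝ) + b = 1 := by exact_mod_cast hab
  have key : ∀ x : ℝ, 0 < x →
      0 ≤ 1 / 2 * Real.log (1 / 2 / x) + (1 / (2 * (1 / 2)) - 1 / (2 * x)) * x := by
    intro x hx
    have h := Real.log_le_sub_one_of_pos (show 0 < 2 * x by positivity)
    rw [show 1 / 2 / x = (2 * x)⁻¹ by field_simp, Real.log_inv]
    field_simp
    linarith
  rw [mutInfo, map_fst_rotGaussian, map_snd_rotGaussian, hab, ← rotGaussian_half_half,
    klDiv_rotGaussian, klDiv_gaussianReal ha (by norm_num), klDiv_gaussianReal hb (by norm_num)]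
  push_cast
  rw [← ENNReal.ofReal_add (key a ha') (key b hb')]
  congr 1
  have h1 : ∀ x : ℝ, 0 < x → (1 / (2 * (1 / 2)) - 1 / (2 * x)) * x = x - 1 / 2 := by
    intro x hx
    field_simp
  rw [show 1 / 2 / (a : ℝ) = (2 * (a : ℝ))⁻¹ by field_simp,
    show 1 / 2 / (b : ℝ) = (2 * (b : ℝ))⁻¹ by field_simp,
    Real.log_inv, Real.log_inv, show 4 * (a : ℝ) * b = (2 * a) * (2 * b) by ring,
    Real.log_mul (x := 2 * (a : ℝ)) (by positivity) (by positivity), h1 a ha', h1 b hb']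
  linarith

lemma rotGaussian_eq_withDensity {a A : ℝ≥0} (ha : a ≠ 0) (hA : A ≠ 0) (b : ℝ≥0) :
    rotGaussian a b = (rotGaussian A b).withDensity fun p =>
      ENNReal.ofReal (exp (gaussianLogRatio a A ((p.1 + p.2) / 2))) := by
  have h : (gaussianReal 0 a).prod (gaussianReal 0 b) =
      ((gaussianReal 0 A).prod (gaussianReal 0 b)).withDensity fun p =>
        ENNReal.ofReal (exp (gaussianLogRatio a A p.1)) := by
    rw [gaussianReal_eq_withDensity_gaussianReal ha hA]
    exact prod_withDensity_left (by fun_prop)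
  rw [rotGaussian, h, rotGaussian]
  ext s hs
  rw [Measure.map_apply measurable_rot hs, withDensity_apply _ (measurable_rot hs),
    withDensity_apply _ hs, setLIntegral_map hs (by fun_prop) measurable_rot]
  congr with p
  ring_nf

lemma integrable_gaussianLogRatio_rotGaussian (v w : ℝ) (A b : ℝ≥0) :
    Integrable (fun p : ℝ × ℝ => gaussianLogRatio v w ((p.1 + p.2) / 2)) (rotGaussian A b) := by
  rw [rotGaussian, integrable_map_measure (Measurable.aestronglyMeasurable (by fun_prop))
    measurable_rot.aemeasurable]
  convert (integrable_gaussianLogRatio v w A).comp_fst (gaussianReal 0 b) using 2 with p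
  simp

lemma integral_gaussianLogRatio_rotGaussian (v w : ℝ) (A b : ℝ≥0) :
    ∫ p : ℝ × ℝ, gaussianLogRatio v w ((p.1 + p.2) / 2) ∂(rotGaussian A b) =
      1 / 2 * Real.log (w / v) + (1 / (2 * w) - 1 / (2 * v)) * A := by
  have h := integral_fun_fst (μ := gaussianReal 0 A) (ν := gaussianReal 0 b) (gaussianLogRatio v w)
  rw [probReal_univ, one_smul, integral_gaussianLogRatio] at h
  rw [rotGaussian, integral_map measurable_rot.aemeasurable
    (Measurable.aestronglyMeasurable (by fun_prop)), ← h]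
  congr with p
  congr 1
  ring

end BivariateGaussian

section TwoPointInequality

lemma two_le_rpow_add_rpow {q t : ℝ} (hq0 : 0 < q) (hq1 : q < 1) (ht0 : 0 ≤ t) (ht1 : t < 1) :
    2 ≤ (1 + t) ^ (q - 1) + (1 - t) ^ (q - 1) := by
  have ha : 0 < (1 + t) ^ ((q - 1) / 2) := Real.rpow_pos_of_pos (by linarith) _
  have hb : 0 < (1 - t) ^ ((q - 1) / 2) := Real.rpow_pos_of_pos (by linarith) _
  have hab : 1 ≤ (1 + t) ^ ((q - 1) / 2) * (1 - t) ^ ((q - 1) / 2) := by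
    rw [← Real.mul_rpow (by linarith) (by linarith)]
    exact Real.one_le_rpow_of_pos_of_le_one_of_nonpos (by nlinarith) (by nlinarith) (by linarith)
  have hsq : ∀ x : ℝ, 0 ≤ x → x ^ (q - 1) = (x ^ ((q - 1) / 2)) ^ 2 := by
    intro x hx
    rw [← Real.rpow_natCast, ← Real.rpow_mul hx]
    congr 1
    push_cast
    ring
  rw [hsq _ (by linarith), hsq _ (by linarith)]
  nlinarith [sq_nonneg ((1 + t) ^ ((q - 1) / 2) - (1 - t) ^ ((q - 1) / 2))]

lemma two_mul_le_rpow_sub_rpow {q t : ℝ} (hq0 : 0 < q) (hq1 : q < 1) (ht0 : 0 ≤ t) (ht1 : t ≤ 1) :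
    2 * q * t ≤ (1 + t) ^ q - (1 - t) ^ q := by
  have hd : ∀ x ∈ Ioo (0 : ℝ) 1, HasDerivAt (fun x : ℝ => (1 + x) ^ q - (1 - x) ^ q - 2 * q * x)
      (q * ((1 + x) ^ (q - 1) + (1 - x) ^ (q - 1) - 2)) x := by
    intro x hx
    have h1 := ((hasDerivAt_id x).const_add 1).rpow_const (p := q)
      (Or.inl (by simp only [id]; linarith [hx.1]))
    have h2 := ((hasDerivAt_id x).const_sub 1).rpow_const (p := q)
      (Or.inl (by simp only [id]; linarith [hx.2]))
    refine ((h1.sub h2).sub ((hasDerivAt_id x).const_mul (2 * q))).congr_deriv ?_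
    simp only [id]
    ring
  have hm : MonotoneOn (fun x : ℝ => (1 + x) ^ q - (1 - x) ^ q - 2 * q * x) (Icc 0 1) := by
    refine monotoneOn_of_deriv_nonneg (convex_Icc 0 1) ?_ ?_ ?_
    · exact Continuous.continuousOn (((Real.continuous_rpow_const hq0.le).comp (by fun_prop)).sub
        ((Real.continuous_rpow_const hq0.le).comp (by fun_prop)) |>.sub (by fun_prop))
    · rw [interior_Icc]
      exact fun x hx => (hd x hx).differentiableAt.differentiableWithinAt
    · rw [interior_Icc]
      intro x hx
      rw [(hd x hx).deriv]
      have := two_le_rpow_add_rpow hq0 hq1 hx.1.le hx.2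
      exact mul_nonneg hq0.le (by linarith)
  have h := hm (left_mem_Icc.2 zero_le_one) ⟨ht0, ht1⟩ ht0
  simp only [add_zero, sub_zero, mul_zero, Real.one_rpow, sub_self] at h
  linarith

lemma two_add_le_rpow_add_rpow {q t : ℝ} (hq0 : 0 < q) (hq1 : q < 1) (ht0 : 0 ≤ t) (ht1 : t ≤ 1) :
    2 + (1 + q) * q * t ^ 2 ≤ (1 + t) ^ (1 + q) + (1 - t) ^ (1 + q) := by
  have hd : ∀ x ∈ Ioo (0 : ℝ) 1,
      HasDerivAt (fun x : ℝ => (1 + x) ^ (1 + q) + (1 - x) ^ (1 + q) - (1 + q) * q * x ^ 2)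
        ((1 + q) * ((1 + x) ^ q - (1 - x) ^ q - 2 * q * x)) x := by
    intro x hx
    have h1 := ((hasDerivAt_id x).const_add 1).rpow_const (p := 1 + q)
      (Or.inl (by simp only [id]; linarith [hx.1]))
    have h2 := ((hasDerivAt_id x).const_sub 1).rpow_const (p := 1 + q)
      (Or.inl (by simp only [id]; linarith [hx.2]))
    refine ((h1.add h2).sub ((hasDerivAt_pow 2 x).const_mul ((1 + q) * q))).congr_deriv ?_
    simp only [id, add_sub_cancel_left]
    push_cast
    ring
  have hm : MonotoneOn
      (fun x : ℝ => (1 + x) ^ (1 + q) + (1 - x) ^ (1 + q) - (1 + q) * q * x ^ 2) (Icc 0 1) := by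
    have hc := Real.continuous_rpow_const (show 0 ≤ 1 + q by linarith)
    refine monotoneOn_of_deriv_nonneg (convex_Icc 0 1) ?_ ?_ ?_
    · exact Continuous.continuousOn ((hc.comp (by fun_prop)).add (hc.comp (by fun_prop))
        |>.sub (by fun_prop))
    · rw [interior_Icc]
      exact fun x hx => (hd x hx).differentiableAt.differentiableWithinAt
    · rw [interior_Icc]
      intro x hx
      rw [(hd x hx).deriv]
      have := two_mul_le_rpow_sub_rpow hq0 hq1 hx.1.le hx.2.le
      exact mul_nonneg (by linarith) (by linarith)
  have h := hm (left_mem_Icc.2 zero_le_one) ⟨ht0, ht1⟩ ht0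
  simp only [add_zero, sub_zero, Real.one_rpow] at h
  norm_num at h
  linarith

/-- Bonami's two-point inequality from `L^(1+q)` to `L^2`. -/
lemma two_point_inequality {q : ℝ} (hq0 : 0 < q) (hq1 : q < 1) {A B : ℝ} (hA : 0 ≤ A)
    (hB : 0 ≤ B) :
    √(((A + B) / 2) ^ 2 + q * ((A - B) / 2) ^ 2) ≤
      (1 / 2 * (A ^ (1 + q) + B ^ (1 + q))) ^ (1 / (1 + q)) := by
  wlog hAB : B ≤ A generalizing A B
  · have h := this hB hA (le_of_not_ge hAB)
    convert h using 2
    · ring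
    · ring
  rcases hA.eq_or_lt with rfl | hA'
  · obtain rfl : B = 0 := le_antisymm hAB hB
    simp
    positivity
  have hm : 0 < (A + B) / 2 := by positivity
  set m := (A + B) / 2 with hm_def
  set t := (A - B) / (A + B) with ht_def
  have ht0 : 0 ≤ t := div_nonneg (by linarith) (by linarith)
  have ht1 : t ≤ 1 := (div_le_one (by linarith)).2 (by linarith)
  have hAm : A = m * (1 + t) := by rw [hm_def, ht_def]; field_simp; ring
  have hBm : B = m * (1 - t) := by rw [hm_def, ht_def]; field_simp; ring
  have hdm : (A - B) / 2 = m * t := by rw [hm_def, ht_def]; field_simp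
  have hbern : (1 + q * t ^ 2) ^ ((1 + q) / 2) ≤
      1 / 2 * ((1 + t) ^ (1 + q) + (1 - t) ^ (1 + q)) := by
    have h1 := rpow_one_add_le_one_add_mul_self (s := q * t ^ 2) (p := (1 + q) / 2)
      (by nlinarith [mul_nonneg hq0.le (sq_nonneg t)]) (by linarith) (by linarith)
    have h2 := two_add_le_rpow_add_rpow hq0 hq1 ht0 ht1
    nlinarith
  have hs : √(1 + q * t ^ 2) ≤
      (1 / 2 * ((1 + t) ^ (1 + q) + (1 - t) ^ (1 + q))) ^ (1 / (1 + q)) := by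
    have h0 : 0 ≤ 1 + q * t ^ 2 := by positivity
    have h := Real.rpow_le_rpow (Real.rpow_nonneg h0 _) hbern
      (show 0 ≤ 1 / (1 + q) by positivity)
    rw [← Real.rpow_mul h0] at h
    rw [Real.sqrt_eq_rpow]
    convert h using 2
    field_simp
  have hL : √(m ^ 2 + q * ((A - B) / 2) ^ 2) = m * √(1 + q * t ^ 2) := by
    rw [hdm, show m ^ 2 + q * (m * t) ^ 2 = m ^ 2 * (1 + q * t ^ 2) by ring,
      Real.sqrt_mul (by positivity), Real.sqrt_sq hm.le]
  have hR : (1 / 2 * (A ^ (1 + q) + B ^ (1 + q))) ^ (1 / (1 + q)) =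
      m * (1 / 2 * ((1 + t) ^ (1 + q) + (1 - t) ^ (1 + q))) ^ (1 / (1 + q)) := by
    have h1 : 0 ≤ (1 + t) ^ (1 + q) := Real.rpow_nonneg (by linarith) _
    have h2 : 0 ≤ (1 - t) ^ (1 + q) := Real.rpow_nonneg (by linarith) _
    have h3 : (m ^ (1 + q)) ^ (1 / (1 + q)) = m := by
      rw [← Real.rpow_mul hm.le, mul_one_div_cancel (by linarith), Real.rpow_one]
    conv_rhs => rw [← h3]
    rw [← Real.mul_rpow (by positivity) (by positivity)]
    conv_lhs => rw [hAm, hBm, Real.mul_rpow hm.le (by linarith), Real.mul_rpow hm.le (by linarith)]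
    congr 1
    ring
  rw [hL, hR]
  gcongr

lemma two_point_bilinear {q : ℝ} (hq0 : 0 < q) (hq1 : q < 1) {A B C D : ℝ} (hA : 0 ≤ A)
    (hB : 0 ≤ B) (hC : 0 ≤ C) (hD : 0 ≤ D) :
    (1 + q) / 4 * (A * C + B * D) + (1 - q) / 4 * (A * D + B * C) ≤
      (1 / 2 * (A ^ (1 + q) + B ^ (1 + q))) ^ (1 / (1 + q)) *
        (1 / 2 * (C ^ (1 + q) + D ^ (1 + q))) ^ (1 / (1 + q)) := by
  have h1 := two_point_inequality hq0 hq1 hA hB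
  have h2 := two_point_inequality hq0 hq1 hC hD
  refine le_trans ?_ (mul_le_mul h1 h2 (Real.sqrt_nonneg _) ((Real.sqrt_nonneg _).trans h1))
  rw [← Real.sqrt_mul (by positivity)]
  apply Real.le_sqrt_of_sq_le
  nlinarith [mul_nonneg hq0.le
    (sq_nonneg ((A + B) / 2 * ((C - D) / 2) - (A - B) / 2 * ((C + D) / 2)))]

lemma two_point_bilinear_ennreal {q : ℝ} (hq0 : 0 < q) (hq1 : q < 1) (A B C D : ℝ≥0∞) :
    ENNReal.ofReal ((1 + q) / 4) * (A * C + B * D) +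
        ENNReal.ofReal ((1 - q) / 4) * (A * D + B * C) ≤
      (ENNReal.ofReal (1 / 2) * (A ^ (1 + q) + B ^ (1 + q))) ^ (1 / (1 + q)) *
        (ENNReal.ofReal (1 / 2) * (C ^ (1 + q) + D ^ (1 + q))) ^ (1 / (1 + q)) := by
  have hp : 0 < 1 + q := by linarith
  have hp' : 0 < 1 / (1 + q) := by positivity
  have htop : ∀ A B : ℝ≥0∞, A = ∞ ∨ B = ∞ →
      (ENNReal.ofReal (1 / 2) * (A ^ (1 + q) + B ^ (1 + q))) ^ (1 / (1 + q)) = ∞ := by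
    rintro A B (rfl | rfl) <;>
    · simp only [ENNReal.top_rpow_of_pos hp, top_add, add_top]
      rw [ENNReal.mul_top (by simp), ENNReal.top_rpow_of_pos hp']
  have hzero : ∀ A B : ℝ≥0∞,
      (ENNReal.ofReal (1 / 2) * (A ^ (1 + q) + B ^ (1 + q))) ^ (1 / (1 + q)) = 0 →
        A = 0 ∧ B = 0 := by
    intro A B h
    rw [ENNReal.rpow_eq_zero_iff_of_pos hp', mul_eq_zero, add_eq_zero,
      ENNReal.rpow_eq_zero_iff_of_pos hp, ENNReal.rpow_eq_zero_iff_of_pos hp] at h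
    rcases h with h | h
    · norm_num at h
    · exact h
  by_cases hAB : A = ∞ ∨ B = ∞
  · rw [htop A B hAB]
    rcases eq_or_ne ((ENNReal.ofReal (1 / 2) * (C ^ (1 + q) + D ^ (1 + q))) ^ (1 / (1 + q))) 0
      with h | h
    · obtain ⟨rfl, rfl⟩ := hzero C D h
      simp
    · rw [ENNReal.top_mul h]
      exact le_top
  by_cases hCD : C = ∞ ∨ D = ∞
  · rw [htop C D hCD]
    rcases eq_or_ne ((ENNReal.ofReal (1 / 2) * (A ^ (1 + q) + B ^ (1 + q))) ^ (1 / (1 + q))) 0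
      with h | h
    · obtain ⟨rfl, rfl⟩ := hzero A B h
      simp
    · rw [ENNReal.mul_top h]
      exact le_top
  push Not at hAB hCD
  obtain ⟨⟨hA, hB⟩, hC, hD⟩ := And.intro hAB hCD
  have h := ENNReal.ofReal_le_ofReal (two_point_bilinear hq0 hq1 (A := A.toReal) (B := B.toReal)
    (C := C.toReal) (D := D.toReal) (by simp) (by simp) (by simp) (by simp))
  have hq : 0 ≤ (1 - q) / 4 := by linarith
  rw [ENNReal.ofReal_add (by positivity) (by positivity), ENNReal.ofReal_mul (by positivity),
    ENNReal.ofReal_mul hq, ENNReal.ofReal_add (by positivity) (by positivity),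
    ENNReal.ofReal_add (by positivity) (by positivity), ENNReal.ofReal_mul (by positivity),
    ENNReal.ofReal_mul (by positivity), ENNReal.ofReal_mul (by positivity),
    ENNReal.ofReal_mul (by positivity), ENNReal.ofReal_mul (by positivity),
    ← ENNReal.ofReal_rpow_of_nonneg (by positivity) hp'.le,
    ← ENNReal.ofReal_rpow_of_nonneg (by positivity) hp'.le,
    ENNReal.ofReal_mul (by positivity), ENNReal.ofReal_mul (by positivity),
    ENNReal.ofReal_add (by positivity) (by positivity),
    ENNReal.ofReal_add (by positivity) (by positivity),
    ← ENNReal.ofReal_rpow_of_nonneg (by positivity) hp.le,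
    ← ENNReal.ofReal_rpow_of_nonneg (by positivity) hp.le,
    ← ENNReal.ofReal_rpow_of_nonneg (by positivity) hp.le,
    ← ENNReal.ofReal_rpow_of_nonneg (by positivity) hp.le,
    ENNReal.ofReal_toReal hA, ENNReal.ofReal_toReal hB, ENNReal.ofReal_toReal hC,
    ENNReal.ofReal_toReal hD] at h
  exact h

end TwoPointInequality

section Hypercontractivity

/-- `κ` satisfies the two-function hypercontractive inequality with both exponents `p`. -/
def IsHypercontractive (p : ℝ) (κ : Measure (ℝ × ℝ)) : Prop :=
  ∀ F G : ℝ → ℝ≥0∞, Measurable F → Measurable G →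
    ∫⁻ z, F z.1 * G z.2 ∂κ ≤
      (∫⁻ z, F z.1 ^ p ∂κ) ^ (1 / p) * (∫⁻ z, G z.2 ^ p ∂κ) ^ (1 / p)

lemma IsHypercontractive.conv {p : ℝ} (hp : 0 < p) {κ κ' : Measure (ℝ × ℝ)} [SFinite κ]
    [SFinite κ'] (h : IsHypercontractive p κ) (h' : IsHypercontractive p κ') :
    IsHypercontractive p (κ ∗ κ') := by
  intro F G hF hG
  rw [Measure.lintegral_conv (by fun_prop), Measure.lintegral_conv (by fun_prop),
    Measure.lintegral_conv (by fun_prop)]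
  simp only [Prod.fst_add, Prod.snd_add]
  have hmF : Measurable fun u : ℝ => ∫⁻ w, F (u + w.1) ^ p ∂κ' := by
    have : Measurable fun q : ℝ × (ℝ × ℝ) => F (q.1 + q.2.1) ^ p := by fun_prop
    exact this.lintegral_prod_right'
  have hmG : Measurable fun u : ℝ => ∫⁻ w, G (u + w.2) ^ p ∂κ' := by
    have : Measurable fun q : ℝ × (ℝ × ℝ) => G (q.1 + q.2.2) ^ p := by fun_prop
    exact this.lintegral_prod_right'
  calc ∫⁻ z, ∫⁻ w, F (z.1 + w.1) * G (z.2 + w.2) ∂κ' ∂κ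
      ≤ ∫⁻ z, (∫⁻ w, F (z.1 + w.1) ^ p ∂κ') ^ (1 / p) *
          (∫⁻ w, G (z.2 + w.2) ^ p ∂κ') ^ (1 / p) ∂κ :=
        lintegral_mono fun z => h' (fun u => F (z.1 + u)) (fun u => G (z.2 + u))
          (by fun_prop) (by fun_prop)
    _ ≤ _ := by
        refine (h (fun u => (∫⁻ w, F (u + w.1) ^ p ∂κ') ^ (1 / p))
          (fun u => (∫⁻ w, G (u + w.2) ^ p ∂κ') ^ (1 / p))
          (hmF.pow_const _) (hmG.pow_const _)).trans_eq ?_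
        simp only [← ENNReal.rpow_mul, one_div_mul_cancel hp.ne', ENNReal.rpow_one]

lemma isHypercontractive_dirac {p : ℝ} (hp : 0 < p) (x : ℝ × ℝ) :
    IsHypercontractive p (Measure.dirac x) := by
  intro F G hF hG
  rw [lintegral_dirac' _ (by fun_prop), lintegral_dirac' _ (by fun_prop),
    lintegral_dirac' _ (by fun_prop), ← ENNReal.rpow_mul, ← ENNReal.rpow_mul,
    mul_one_div_cancel hp.ne', ENNReal.rpow_one, ENNReal.rpow_one]

/-- The law of a pair of `± c` valued symmetric signs with correlation `r`. -/
noncomputable def signLaw (r c : ℝ) : Measure (ℝ × ℝ) :=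
  ENNReal.ofReal ((1 + r) / 4) • (Measure.dirac (c, c) + Measure.dirac (-c, -c)) +
    ENNReal.ofReal ((1 - r) / 4) • (Measure.dirac (c, -c) + Measure.dirac (-c, c))

lemma lintegral_signLaw (r c : ℝ) {f : ℝ × ℝ → ℝ≥0∞} (hf : Measurable f) :
    ∫⁻ z, f z ∂signLaw r c = ENNReal.ofReal ((1 + r) / 4) * (f (c, c) + f (-c, -c)) +
      ENNReal.ofReal ((1 - r) / 4) * (f (c, -c) + f (-c, c)) := by
  simp only [signLaw, lintegral_add_measure, lintegral_smul_measure, lintegral_dirac' _ hf,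
    smul_eq_mul]

lemma isProbabilityMeasure_signLaw {r : ℝ} (hr0 : -1 ≤ r) (hr1 : r ≤ 1) (c : ℝ) :
    IsProbabilityMeasure (signLaw r c) := by
  constructor
  rw [← lintegral_one, lintegral_signLaw _ _ measurable_const]
  rw [one_add_one_eq_two, ← add_mul, ← ENNReal.ofReal_add (by linarith) (by linarith),
    ← ENNReal.ofReal_ofNat 2, ← ENNReal.ofReal_mul (by linarith)]
  norm_num
  ring

lemma isHypercontractive_signLaw {r : ℝ} (hr0 : 0 < r) (hr1 : r < 1) (c : ℝ) :
    IsHypercontractive (1 + r) (signLaw r c) := by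
  intro F G hF hG
  rw [lintegral_signLaw _ _ (by fun_prop), lintegral_signLaw _ _ (by fun_prop),
    lintegral_signLaw _ _ (by fun_prop)]
  refine (two_point_bilinear_ennreal hr0 hr1 (F c) (F (-c)) (G c) (G (-c))).trans_eq ?_
  have h : ENNReal.ofReal (1 / 2) =
      ENNReal.ofReal ((1 + r) / 4) + ENNReal.ofReal ((1 - r) / 4) := by
    rw [← ENNReal.ofReal_add (by linarith) (by linarith)]
    congr 1
    ring
  rw [h]
  dsimp only
  congr 2 <;> ring

lemma integral_signLaw {r : ℝ} (hr0 : -1 ≤ r) (hr1 : r ≤ 1) (c : ℝ) (f : ℝ × ℝ → ℂ) :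
    ∫ z, f z ∂signLaw r c = ((1 + r) / 4 : ℝ) * (f (c, c) + f (-c, -c)) +
      ((1 - r) / 4 : ℝ) * (f (c, -c) + f (-c, c)) := by
  have hi : ∀ x : ℝ × ℝ, Integrable f (Measure.dirac x) := fun x =>
    integrable_dirac (by simp)
  rw [signLaw, integral_add_measure, integral_smul_measure, integral_smul_measure,
    integral_add_measure (hi _) (hi _), integral_add_measure (hi _) (hi _)]
  · simp only [integral_dirac, ENNReal.toReal_ofReal (show 0 ≤ (1 + r) / 4 by linarith),
      ENNReal.toReal_ofReal (show 0 ≤ (1 - r) / 4 by linarith), Complex.real_smul]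
  · exact ((hi _).add_measure (hi _)).smul_measure (by simp)
  · exact ((hi _).add_measure (hi _)).smul_measure (by simp)

/-- The value at `(s, t)` of the characteristic function of a measure on the plane. -/
noncomputable def planeCharFun (σ : Measure (ℝ × ℝ)) (s t : ℝ) : ℂ :=
  ∫ z, Complex.exp ((s * z.1 + t * z.2 : ℝ) * Complex.I) ∂σ

lemma integrable_exp_mul_I {σ : Measure (ℝ × ℝ)} [IsFiniteMeasure σ] {f : ℝ × ℝ → ℝ}
    (hf : Measurable f) : Integrable (fun z => Complex.exp (f z * Complex.I)) σ :=
  (integrable_const (1 : ℝ)).mono (by fun_prop) (by simp [Complex.norm_exp_ofReal_mul_I])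

lemma planeCharFun_conv (σ τ : Measure (ℝ × ℝ)) [IsFiniteMeasure σ] [IsFiniteMeasure τ]
    (s t : ℝ) : planeCharFun (σ ∗ τ) s t = planeCharFun σ s t * planeCharFun τ s t := by
  unfold planeCharFun
  rw [integral_conv (integrable_exp_mul_I (by fun_prop))]
  have h : ∀ z w : ℝ × ℝ, Complex.exp ((s * (z + w).1 + t * (z + w).2 : ℝ) * Complex.I) =
      Complex.exp ((s * z.1 + t * z.2 : ℝ) * Complex.I) *
        Complex.exp ((s * w.1 + t * w.2 : ℝ) * Complex.I) := by
    intro z w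
    rw [← Complex.exp_add]
    congr 1
    push_cast [Prod.fst_add, Prod.snd_add]
    ring
  simp_rw [h, integral_const_mul, integral_mul_const]

lemma planeCharFun_signLaw {r : ℝ} (hr0 : -1 ≤ r) (hr1 : r ≤ 1) (c s t : ℝ) :
    planeCharFun (signLaw r c) s t =
      ((1 + r) / 2 * cos (c * (s + t)) + (1 - r) / 2 * cos (c * (s - t)) : ℝ) := by
  rw [planeCharFun, integral_signLaw hr0 hr1]
  push_cast [Complex.cos]
  ring_nf

lemma exists_isHypercontractive_pow {r : ℝ} (hr0 : 0 < r) (hr1 : r < 1) (c : ℝ) (n : ℕ) :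
    ∃ σ : ProbabilityMeasure (ℝ × ℝ), IsHypercontractive (1 + r) (σ : Measure (ℝ × ℝ)) ∧
      ∀ s t, planeCharFun σ s t =
        ((1 + r) / 2 * cos (c * (s + t)) + (1 - r) / 2 * cos (c * (s - t)) : ℝ) ^ n := by
  induction n with
  | zero =>
    refine ⟨⟨Measure.dirac 0, inferInstance⟩, isHypercontractive_dirac (by linarith) 0, ?_⟩
    intro s t
    simp [planeCharFun]
  | succ n ih =>
    obtain ⟨σ, hσ, hσ'⟩ := ih
    have := isProbabilityMeasure_signLaw (by linarith) hr1.le c (r := r)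
    refine ⟨⟨σ ∗ signLaw r c, inferInstance⟩,
      hσ.conv (by linarith) (isHypercontractive_signLaw hr0 hr1 c), fun s t => ?_⟩
    simp only [ProbabilityMeasure.coe_mk]
    rw [planeCharFun_conv, hσ', planeCharFun_signLaw (by linarith) hr1.le, pow_succ]

lemma planeCharFun_rotGaussian (a b : ℝ≥0) (s t : ℝ) :
    planeCharFun (rotGaussian a b) s t =
      (exp (-((s + t) ^ 2 * a + (s - t) ^ 2 * b) / 2) : ℝ) := by
  have h := congrArg (fun m => charFun m 1) (map_linearCombination_rotGaussian a b s t)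
  simp only [charFun_gaussianReal] at h
  rw [charFun_apply_real, integral_map (by fun_prop) (by fun_prop)] at h
  have h2 : planeCharFun (rotGaussian a b) s t =
      ∫ x, Complex.exp (((1 : ℝ) : ℂ) * ((s * x.1 + t * x.2 : ℝ) : ℂ) * Complex.I)
        ∂rotGaussian a b := by
    simp [planeCharFun]
  rw [h2, h, Real.coe_toNNReal _ (by positivity)]
  push_cast
  congr 1
  ring

lemma tendsto_of_tendsto_planeCharFun {σ : ℕ → ProbabilityMeasure (ℝ × ℝ)}
    {κ : ProbabilityMeasure (ℝ × ℝ)}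
    (h : ∀ s t, Tendsto (fun n => planeCharFun (σ n) s t) atTop (𝓝 (planeCharFun κ s t))) :
    Tendsto σ atTop (𝓝 κ) := by
  have hc : Continuous (WithLp.toLp 2 : ℝ × ℝ → WithLp 2 (ℝ × ℝ)) :=
    WithLp.prod_continuous_toLp 2 ℝ ℝ
  have hc' : Continuous (WithLp.ofLp : WithLp 2 (ℝ × ℝ) → ℝ × ℝ) :=
    WithLp.prod_continuous_ofLp 2 ℝ ℝ
  have key : ∀ (τ : ProbabilityMeasure (ℝ × ℝ)) (u : WithLp 2 (ℝ × ℝ)),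
      charFun (τ.map hc.measurable.aemeasurable : Measure (WithLp 2 (ℝ × ℝ))) u =
        planeCharFun τ u.fst u.snd := by
    intro τ u
    rw [charFun_apply, ProbabilityMeasure.toMeasure_map,
      integral_map hc.measurable.aemeasurable (by fun_prop)]
    simp only [planeCharFun, WithLp.prod_inner_apply, RCLike.inner_apply, conj_trivial]
    rfl
  have h1 : Tendsto (fun n => (σ n).map hc.measurable.aemeasurable) atTop
      (𝓝 (κ.map hc.measurable.aemeasurable)) := by
    refine ProbabilityMeasure.tendsto_of_tendsto_charFun fun u => ?_
    simp only [key]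
    exact h _ _
  have h2 := ProbabilityMeasure.tendsto_map_of_tendsto_of_continuous _ _ h1 hc'
  have h3 : ∀ τ : ProbabilityMeasure (ℝ × ℝ),
      (τ.map hc.measurable.aemeasurable).map hc'.measurable.aemeasurable = τ := by
    intro τ
    apply Subtype.ext
    change (((τ.map hc.measurable.aemeasurable).map hc'.measurable.aemeasurable :
      ProbabilityMeasure (ℝ × ℝ)) : Measure (ℝ × ℝ)) = τ
    rw [ProbabilityMeasure.toMeasure_map, ProbabilityMeasure.toMeasure_map,
      Measure.map_map hc'.measurable hc.measurable]
    exact Measure.map_id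
  simpa only [h3] using h2

end Hypercontractivity

section GaussianHypercontractivity

lemma tendsto_nat_mul_cos_div_sqrt_sub_one (x : ℝ) :
    Tendsto (fun n : ℕ => (n : ℝ) * (cos (x / √n) - 1)) atTop (𝓝 (-(x ^ 2 / 2))) := by
  rw [tendsto_iff_norm_sub_tendsto_zero]
  have hlim : Tendsto (fun n : ℕ => |x| ^ 4 * (5 / 96) * (n : ℝ)⁻¹) atTop (𝓝 0) := by
    simpa using (tendsto_inv_atTop_nhds_zero_nat (𝕜 := ℝ)).const_mul (|x| ^ 4 * (5 / 96))
  refine squeeze_zero' (Eventually.of_forall fun n => norm_nonneg _) ?_ hlim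
  have hs : Tendsto (fun n : ℕ => √(n : ℝ)) atTop atTop :=
    Real.tendsto_sqrt_atTop.comp tendsto_natCast_atTop_atTop
  filter_upwards [hs.eventually_ge_atTop (max |x| 1)] with n hn
  have hpos : 0 < √(n : ℝ) := lt_of_lt_of_le (by positivity) ((le_max_right _ _).trans hn)
  have hsq : √(n : ℝ) ^ 2 = n := Real.sq_sqrt (Nat.cast_nonneg n)
  have hn0 : (0 : ℝ) < n := by rw [← hsq]; positivity
  have h := Real.cos_bound (x := x / √n) (by
    rw [abs_div, abs_of_pos hpos]
    exact (div_le_one hpos).2 ((le_max_left _ _).trans hn))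
  have h4 : |x / √(n : ℝ)| ^ 4 = |x| ^ 4 / (n : ℝ) ^ 2 := by
    rw [abs_div, abs_of_pos hpos, div_pow, show √(n : ℝ) ^ 4 = (√(n : ℝ) ^ 2) ^ 2 by ring, hsq]
  have h2 : (x / √(n : ℝ)) ^ 2 = x ^ 2 / n := by rw [div_pow, hsq]
  rw [h4, h2] at h
  have heq : (n : ℝ) * (cos (x / √n) - 1) - -(x ^ 2 / 2) =
      n * (cos (x / √n) - (1 - x ^ 2 / n / 2)) := by field_simp; ring
  rw [heq, Real.norm_eq_abs, abs_mul, abs_of_pos hn0]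
  calc (n : ℝ) * |cos (x / √n) - (1 - x ^ 2 / n / 2)|
      ≤ n * (|x| ^ 4 / (n : ℝ) ^ 2 * (5 / 96)) := by gcongr
    _ = _ := by field_simp

lemma exists_isHypercontractive_tendsto_rotGaussian {a b : ℝ≥0} (hb : 0 < b) (hab : b < a) :
    ∃ σ : ℕ → ProbabilityMeasure (ℝ × ℝ),
      (∀ n, IsHypercontractive (2 * a / (a + b)) (σ n : Measure (ℝ × ℝ))) ∧
      Tendsto σ atTop (𝓝 ⟨rotGaussian a b, inferInstance⟩) := by
  have hb' : (0 : ℝ) < b := hb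
  have hab' : (b : ℝ) < a := hab
  set r : ℝ := (a - b) / (a + b) with hr
  have hr0 : 0 < r := div_pos (by linarith) (by linarith)
  have hr1 : r < 1 := (div_lt_one (by linarith)).2 (by linarith)
  have hp : (2 * a / (a + b) : ℝ) = 1 + r := by rw [hr]; field_simp; ring
  choose σ hσ hσ' using fun n : ℕ =>
    exists_isHypercontractive_pow hr0 hr1 (√(a + b : ℝ) / √n) n
  refine ⟨σ, fun n => hp ▸ hσ n, tendsto_of_tendsto_planeCharFun fun s t => ?_⟩
  simp only [hσ', ProbabilityMeasure.coe_mk, planeCharFun_rotGaussian, ← Complex.ofReal_pow]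
  refine (Complex.continuous_ofReal.tendsto _).comp ?_
  have h1 := tendsto_nat_mul_cos_div_sqrt_sub_one (√(a + b : ℝ) * (s + t))
  have h2 := tendsto_nat_mul_cos_div_sqrt_sub_one (√(a + b : ℝ) * (s - t))
  have h := (h1.const_mul ((1 + r) / 2)).add (h2.const_mul ((1 - r) / 2))
  have h3 : (1 + r) / 2 * -((√(a + b : ℝ) * (s + t)) ^ 2 / 2) +
      (1 - r) / 2 * -((√(a + b : ℝ) * (s - t)) ^ 2 / 2) =
        -((s + t) ^ 2 * a + (s - t) ^ 2 * b) / 2 := by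
    rw [mul_pow, mul_pow, Real.sq_sqrt (by positivity), hr]
    field_simp
    ring
  rw [h3] at h
  have h4 := Real.tendsto_one_add_pow_exp_of_tendsto
    (g := fun n : ℕ => (1 + r) / 2 * (cos (√(a + b : ℝ) * (s + t) / √n) - 1) +
      (1 - r) / 2 * (cos (√(a + b : ℝ) * (s - t) / √n) - 1))
    (h.congr fun n => by ring)
  refine h4.congr fun n => ?_
  congr 1
  rw [div_mul_eq_mul_div, div_mul_eq_mul_div]
  ring_nf

lemma tendsto_lintegral_of_continuous_le {E : Type*} [TopologicalSpace E] [MeasurableSpace E]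
    [OpensMeasurableSpace E] {σ : ℕ → ProbabilityMeasure E} {κ : ProbabilityMeasure E}
    (h : Tendsto σ atTop (𝓝 κ)) {f : E → ℝ≥0} (hf : Continuous f) {M : ℝ≥0} (hM : ∀ x, f x ≤ M) :
    Tendsto (fun n => ∫⁻ x, f x ∂(σ n : Measure E)) atTop (𝓝 (∫⁻ x, f x ∂(κ : Measure E))) := by
  have hd : ∀ x y, dist (f x) (f y) ≤ M := by
    intro x y
    rw [NNReal.dist_eq, abs_le]
    have h1 : (f x : ℝ) ≤ M := hM x
    have h2 : (f y : ℝ) ≤ M := hM y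
    constructor <;> linarith [(f x).2, (f y).2, NNReal.coe_nonneg (f x), NNReal.coe_nonneg (f y)]
  exact ProbabilityMeasure.tendsto_iff_forall_lintegral_tendsto.1 h
    (BoundedContinuousFunction.mkOfBound ⟨f, hf⟩ M hd)

lemma lintegral_mul_le_of_tendsto {p : ℝ} (hp : 0 < p) {σ : ℕ → ProbabilityMeasure (ℝ × ℝ)}
    {κ : ProbabilityMeasure (ℝ × ℝ)} (h : Tendsto σ atTop (𝓝 κ))
    (hσ : ∀ n, IsHypercontractive p (σ n : Measure (ℝ × ℝ))) {F G : ℝ → ℝ≥0}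
    (hF : Continuous F) (hG : Continuous G) {M N : ℝ≥0} (hM : ∀ x, F x ≤ M) (hN : ∀ x, G x ≤ N) :
    ∫⁻ z, F z.1 * G z.2 ∂(κ : Measure (ℝ × ℝ)) ≤
      (∫⁻ z, (F z.1 : ℝ≥0∞) ^ p ∂(κ : Measure (ℝ × ℝ))) ^ (1 / p) *
        (∫⁻ z, (G z.2 : ℝ≥0∞) ^ p ∂(κ : Measure (ℝ × ℝ))) ^ (1 / p) := by
  have hp' := NNReal.continuous_rpow_const hp.le
  have h1 := tendsto_lintegral_of_continuous_le h (f := fun z : ℝ × ℝ => F z.1 * G z.2)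
    (by fun_prop) (M := M * N) (fun z => mul_le_mul' (hM _) (hN _))
  have h2 := tendsto_lintegral_of_continuous_le h (f := fun z : ℝ × ℝ => F z.1 ^ p)
    (by fun_prop) (M := M ^ p) (fun z => NNReal.rpow_le_rpow (hM _) hp.le)
  have h3 := tendsto_lintegral_of_continuous_le h (f := fun z : ℝ × ℝ => G z.2 ^ p)
    (by fun_prop) (M := N ^ p) (fun z => NNReal.rpow_le_rpow (hN _) hp.le)
  have hfin : ∀ {f : ℝ × ℝ → ℝ≥0} {M : ℝ≥0}, (∀ z, f z ≤ M) →
      ∫⁻ z, f z ∂(κ : Measure (ℝ × ℝ)) ≠ ∞ := by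
    intro f M hf
    refine ((lintegral_mono (g := fun _ => (M : ℝ≥0∞)) fun z => ?_).trans_lt ?_).ne
    · exact ENNReal.coe_le_coe.2 (hf z)
    · simp
  simp only [ENNReal.coe_mul, ENNReal.coe_rpow_of_nonneg _ hp.le] at h1 h2 h3
  have h2' := ((ENNReal.continuous_rpow_const (y := 1 / p)).tendsto _).comp h2
  have h3' := ((ENNReal.continuous_rpow_const (y := 1 / p)).tendsto _).comp h3
  refine le_of_tendsto_of_tendsto' h1 (ENNReal.Tendsto.mul h2' (Or.inr ?_) h3' (Or.inr ?_))
    fun n =>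
      hσ n (fun x => F x) (fun x => G x) (by fun_prop) (by fun_prop)
  · refine ENNReal.rpow_ne_top_of_nonneg (by positivity) ?_
    simp only [← ENNReal.coe_rpow_of_nonneg _ hp.le]
    exact hfin (M := N ^ p) fun z => NNReal.rpow_le_rpow (hN z.2) hp.le
  · refine ENNReal.rpow_ne_top_of_nonneg (by positivity) ?_
    simp only [← ENNReal.coe_rpow_of_nonneg _ hp.le]
    exact hfin (M := M ^ p) fun z => NNReal.rpow_le_rpow (hM z.1) hp.le

lemma lintegral_le_of_forall_continuous {p : ℝ} (hp : 1 ≤ p) {m η : Measure ℝ}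
    [IsFiniteMeasure m] (hη : η ≪ m) {C : ℝ≥0∞}
    (h : ∀ f : ℝ → ℝ≥0, Continuous f → (∃ M, ∀ x, f x ≤ M) →
      ∫⁻ x, f x ∂η ≤ (∫⁻ x, (f x : ℝ≥0∞) ^ p ∂m) ^ (1 / p) * C)
    {F : ℝ → ℝ≥0∞} (hF : Measurable F) :
    ∫⁻ x, F x ∂η ≤ (∫⁻ x, F x ^ p ∂m) ^ (1 / p) * C := by
  have hp0 : 0 < p := by linarith
  have hpE : ENNReal.ofReal p ≠ 0 := by simpa using hp0
  have hpR : (ENNReal.ofReal p).toReal = p := ENNReal.toReal_ofReal hp0.le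
  rcases eq_or_ne (∫⁻ x, F x ^ p ∂m) 0 with h0 | h0
  · rw [lintegral_eq_zero_iff (by fun_prop)] at h0
    have : F =ᵐ[η] 0 := by
      filter_upwards [hη.ae_le h0] with x hx
      simpa [ENNReal.rpow_eq_zero_iff_of_pos hp0] using hx
    rw [lintegral_congr_ae this]
    simp
  rcases eq_or_ne C 0 with rfl | hC
  · have h1 := h (fun _ => 1) continuous_const ⟨1, fun _ => le_rfl⟩
    simp only [mul_zero, nonpos_iff_eq_zero, ENNReal.coe_one, lintegral_one,
      Measure.measure_univ_eq_zero] at h1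
    simp [h1]
  rcases eq_or_ne (∫⁻ x, F x ^ p ∂m) ∞ with ht | ht
  · rw [ht, ENNReal.top_rpow_of_pos (by positivity), ENNReal.top_mul hC]
    exact le_top
  rcases eq_or_ne C ∞ with rfl | hCt
  · rw [ENNReal.mul_top]
    · exact le_top
    · rw [Ne, ENNReal.rpow_eq_zero_iff_of_pos (by positivity)]
      exact h0
  have hFt : ∀ᵐ x ∂m, F x < ∞ := by
    filter_upwards [ae_lt_top (by fun_prop) ht] with x hx
    by_contra hx'
    simp [not_lt_top_iff.1 hx', ENNReal.top_rpow_of_pos hp0] at hx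
  have hnorm : ∀ g : ℝ → ℝ, eLpNorm g (ENNReal.ofReal p) m =
      (∫⁻ x, ‖g x‖ₑ ^ p ∂m) ^ (1 / p) := by
    intro g
    rw [eLpNorm_eq_lintegral_rpow_enorm_toReal hpE ENNReal.ofReal_ne_top, hpR]
  have hFn : eLpNorm (fun x => (F x).toReal) (ENNReal.ofReal p) m =
      (∫⁻ x, F x ^ p ∂m) ^ (1 / p) := by
    rw [hnorm]
    congr 1
    refine lintegral_congr_ae ?_
    filter_upwards [hFt] with x hx
    rw [Real.enorm_of_nonneg ENNReal.toReal_nonneg,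
          ENNReal.ofReal_toReal hx.ne]
  have hmem : MemLp (fun x => (F x).toReal) (ENNReal.ofReal p) m := by
    refine ⟨hF.ennreal_toReal.aestronglyMeasurable, ?_⟩
    rw [hFn]
    exact (ENNReal.rpow_ne_top_of_nonneg (by positivity) ht).lt_top
  choose g hg hgm using fun n : ℕ => hmem.exists_boundedContinuous_eLpNorm_sub_le
    ENNReal.ofReal_ne_top (ε := ((n : ℝ≥0∞) + 1)⁻¹) (by simp)
  have hε : Tendsto (fun n : ℕ => ((n : ℝ≥0∞) + 1)⁻¹) atTop (𝓝 0) := by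
    have := (tendsto_add_atTop_iff_nat 1).2 ENNReal.tendsto_inv_nat_nhds_zero
    simpa using this
  have hgT : Tendsto (fun n => eLpNorm ((g n : ℝ → ℝ) - fun x => (F x).toReal)
      (ENNReal.ofReal p) m) atTop (𝓝 0) := by
    refine tendsto_of_tendsto_of_tendsto_of_le_of_le tendsto_const_nhds hε
      (fun _ => zero_le) fun n => ?_
    rw [eLpNorm_sub_comm]
    exact hg n
  obtain ⟨k, hk, hkT⟩ := (tendstoInMeasure_of_tendsto_eLpNorm hpE
    (fun n => (g n).continuous.aestronglyMeasurable) hmem.1 hgT).exists_seq_tendsto_ae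
  have hbound : ∀ n, ∫⁻ x, ‖g n x‖ₑ ∂η ≤
      ((∫⁻ x, F x ^ p ∂m) ^ (1 / p) + ((n : ℝ≥0∞) + 1)⁻¹) * C := by
    intro n
    have h1 := h (fun x => ‖g n x‖₊) (by fun_prop) ⟨‖g n‖₊, fun x => (g n).norm_coe_le_norm x⟩
    refine h1.trans (mul_le_mul_left ?_ C)
    have h2 : eLpNorm (g n : ℝ → ℝ) (ENNReal.ofReal p) m ≤
        eLpNorm (fun x => (F x).toReal) (ENNReal.ofReal p) m +
          eLpNorm ((g n : ℝ → ℝ) - fun x => (F x).toReal) (ENNReal.ofReal p) m := by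
      have := eLpNorm_add_le hmem.1 ((hgm n).1.sub hmem.1)
        (ENNReal.one_le_ofReal.2 hp)
      rwa [add_sub_cancel] at this
    rw [hFn, hnorm, eLpNorm_sub_comm] at h2
    exact h2.trans (by gcongr; exact hg n)
  calc ∫⁻ x, F x ∂η = ∫⁻ x, liminf (fun n => ‖g (k n) x‖ₑ) atTop ∂η := by
        refine lintegral_congr_ae ?_
        filter_upwards [hη.ae_le hFt, hη.ae_le hkT] with x hx hx'
        rw [hx'.enorm.liminf_eq, Real.enorm_of_nonneg ENNReal.toReal_nonneg,
          ENNReal.ofReal_toReal hx.ne]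
    _ ≤ liminf (fun n => ∫⁻ x, ‖g (k n) x‖ₑ ∂η) atTop :=
        lintegral_liminf_le fun n => (g (k n)).continuous.measurable.enorm
    _ ≤ liminf (fun n => ((∫⁻ x, F x ^ p ∂m) ^ (1 / p) + ((k n : ℝ≥0∞) + 1)⁻¹) * C) atTop :=
        liminf_le_liminf (Eventually.of_forall fun n => hbound (k n))
    _ = (∫⁻ x, F x ^ p ∂m) ^ (1 / p) * C := by
        refine Tendsto.liminf_eq ?_
        have h1 := (hε.comp hk.tendsto_atTop).const_add ((∫⁻ x, F x ^ p ∂m) ^ (1 / p))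
        rw [add_zero] at h1
        exact ENNReal.Tendsto.mul_const h1 (Or.inr hCt)

lemma isHypercontractive_of_forall_continuous {p : ℝ} (hp : 1 ≤ p) {κ : Measure (ℝ × ℝ)}
    [IsFiniteMeasure κ]
    (h : ∀ F G : ℝ → ℝ≥0, Continuous F → Continuous G → (∃ M, ∀ x, F x ≤ M) →
      (∃ M, ∀ x, G x ≤ M) → ∫⁻ z, F z.1 * G z.2 ∂κ ≤
        (∫⁻ z, (F z.1 : ℝ≥0∞) ^ p ∂κ) ^ (1 / p) * (∫⁻ z, (G z.2 : ℝ≥0∞) ^ p ∂κ) ^ (1 / p)) :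
    IsHypercontractive p κ := by
  have h1 : ∀ (F : ℝ → ℝ≥0∞) (G : ℝ → ℝ≥0), Measurable F → Continuous G →
      (∃ M, ∀ x, G x ≤ M) → ∫⁻ z, F z.1 * G z.2 ∂κ ≤
        (∫⁻ z, F z.1 ^ p ∂κ) ^ (1 / p) * (∫⁻ z, (G z.2 : ℝ≥0∞) ^ p ∂κ) ^ (1 / p) := by
    intro F G hF hG hG'
    have hη : ∀ f : ℝ → ℝ≥0∞, Measurable f →
        ∫⁻ x, f x ∂(κ.withDensity fun z => (G z.2 : ℝ≥0∞)).map Prod.fst =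
          ∫⁻ z, f z.1 * G z.2 ∂κ := by
      intro f hf
      rw [lintegral_map hf measurable_fst, lintegral_withDensity_eq_lintegral_mul _ (by fun_prop)
        (by fun_prop)]
      simp only [Pi.mul_apply, mul_comm]
    have := lintegral_le_of_forall_continuous hp (m := κ.map Prod.fst)
      (η := (κ.withDensity fun z => (G z.2 : ℝ≥0∞)).map Prod.fst)
      ((withDensity_absolutelyContinuous _ _).map measurable_fst)
      (C := (∫⁻ z, (G z.2 : ℝ≥0∞) ^ p ∂κ) ^ (1 / p)) (fun f hf hf' => by
        rw [hη _ (by fun_prop), lintegral_map (by fun_prop) measurable_fst]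
        exact h f G hf hG hf' hG') hF
    rwa [hη _ hF, lintegral_map (by fun_prop) measurable_fst] at this
  intro F G hF hG
  have hη : ∀ f : ℝ → ℝ≥0∞, Measurable f →
      ∫⁻ x, f x ∂(κ.withDensity fun z => F z.1).map Prod.snd = ∫⁻ z, F z.1 * f z.2 ∂κ := by
    intro f hf
    rw [lintegral_map hf measurable_snd, lintegral_withDensity_eq_lintegral_mul _ (by fun_prop)
      (by fun_prop)]
    simp only [Pi.mul_apply]
  have := lintegral_le_of_forall_continuous hp (m := κ.map Prod.snd)
    (η := (κ.withDensity fun z => F z.1).map Prod.snd)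
    ((withDensity_absolutelyContinuous _ _).map measurable_snd)
    (C := (∫⁻ z, F z.1 ^ p ∂κ) ^ (1 / p)) (fun f hf hf' => by
      rw [hη _ (by fun_prop), lintegral_map (by fun_prop) measurable_snd, mul_comm]
      exact h1 F f hF hf hf') hG
  rwa [hη _ hG, lintegral_map (by fun_prop) measurable_snd, mul_comm] at this

/-- Nelson's hypercontractivity for a centred Gaussian pair with correlation
`(a - b) / (a + b)`. -/
theorem isHypercontractive_rotGaussian {a b : ℝ≥0} (hb : 0 < b) (hab : b < a) :
    IsHypercontractive (2 * a / (a + b)) (rotGaussian a b) := by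
  obtain ⟨σ, hσ, hσT⟩ := exists_isHypercontractive_tendsto_rotGaussian hb hab
  have hb' : (0 : ℝ) < b := hb
  have hab' : (b : ℝ) < a := hab
  have ha' : (0 : ℝ) < a := hb'.trans hab'
  refine isHypercontractive_of_forall_continuous ?_ fun F G hF hG ⟨M, hM⟩ ⟨N, hN⟩ =>
    lintegral_mul_le_of_tendsto (by positivity) hσT hσ hF hG hM hN
  rw [le_div_iff₀ (by positivity)]
  linarith

end GaussianHypercontractivity

section EntropyInequality

lemma lintegral_mul_exp_le_rotGaussian {a A b : ℝ≥0} (hb : 0 < b) (hab : b < a) (hA : A ≠ 0)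
    {F G : ℝ → ℝ≥0∞} (hF : Measurable F) (hG : Measurable G) :
    ∫⁻ z, F z.1 * G z.2 * ENNReal.ofReal (exp (
        1 / (2 * a / (a + b)) * (gaussianLogRatio (A + b) (a + b) z.1 +
          gaussianLogRatio (A + b) (a + b) z.2) +
        gaussianLogRatio a A ((z.1 + z.2) / 2))) ∂rotGaussian A b ≤
      (∫⁻ z, F z.1 ^ (2 * a / (a + b) : ℝ) ∂rotGaussian A b) ^ (1 / (2 * a / (a + b)) : ℝ) *
        (∫⁻ z, G z.2 ^ (2 * a / (a + b) : ℝ) ∂rotGaussian A b) ^ (1 / (2 * a / (a + b)) : ℝ) := by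
  have ha : a ≠ 0 := (hb.trans hab).ne'
  have ha' : (0 : ℝ) < a := hb.trans hab
  have hb' : (0 : ℝ) < b := hb
  have hp : (0 : ℝ) < 2 * a / (a + b) := by positivity
  set p : ℝ := 2 * a / (a + b) with hp_def
  have hE : ∀ x : ℝ, ENNReal.ofReal (exp (1 / p * x)) ^ p = ENNReal.ofReal (exp x) := by
    intro x
    rw [ENNReal.ofReal_rpow_of_pos (exp_pos _), ← Real.exp_mul]
    congr 2
    field_simp
  have hmarg : ∀ f : ℝ → ℝ≥0∞, Measurable f →
      ∫⁻ x, (f x * ENNReal.ofReal (exp (1 / p * gaussianLogRatio (A + b) (a + b) x))) ^ p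
        ∂gaussianReal 0 (a + b) = ∫⁻ x, f x ^ p ∂gaussianReal 0 (A + b) := by
    intro f hf
    rw [gaussianReal_eq_withDensity_gaussianReal (v := A + b) (w := a + b)
      (by positivity) (by positivity), lintegral_withDensity_eq_lintegral_mul _ (by fun_prop)
      (by fun_prop)]
    refine lintegral_congr fun x => ?_
    rw [ENNReal.mul_rpow_of_nonneg _ _ hp.le, hE, Pi.mul_apply, mul_comm]
    simp
  have h := isHypercontractive_rotGaussian hb hab
    (fun x => F x * ENNReal.ofReal (exp (1 / p * gaussianLogRatio (A + b) (a + b) x)))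
    (fun x => G x * ENNReal.ofReal (exp (1 / p * gaussianLogRatio (A + b) (a + b) x)))
    (by fun_prop) (by fun_prop)
  rw [← hp_def] at h
  have e1 : ∀ (f : ℝ → ℝ≥0∞) (c d : ℝ≥0), Measurable f →
      ∫⁻ z, f z.1 ∂rotGaussian c d = ∫⁻ x, f x ∂gaussianReal 0 (c + d) := by
    intro f c d hf
    rw [← map_fst_rotGaussian, lintegral_map hf measurable_fst]
  have e2 : ∀ (f : ℝ → ℝ≥0∞) (c d : ℝ≥0), Measurable f →
      ∫⁻ z, f z.2 ∂rotGaussian c d = ∫⁻ x, f x ∂gaussianReal 0 (c + d) := by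
    intro f c d hf
    rw [← map_snd_rotGaussian, lintegral_map hf measurable_snd]
  rw [e1 (fun x => (F x * ENNReal.ofReal
      (exp (1 / p * gaussianLogRatio (A + b) (a + b) x))) ^ p) a b (by fun_prop),
    e2 (fun x => (G x * ENNReal.ofReal
      (exp (1 / p * gaussianLogRatio (A + b) (a + b) x))) ^ p) a b (by fun_prop),
    hmarg F hF, hmarg G hG, rotGaussian_eq_withDensity ha hA,
    lintegral_withDensity_eq_lintegral_mul _ (by fun_prop) (by fun_prop)] at h
  rw [e1 (fun x => F x ^ p) A b (by fun_prop), e2 (fun x => G x ^ p) A b (by fun_prop)]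
  refine le_trans (lintegral_mono fun z => ?_) h
  refine le_of_eq ?_
  simp only [Pi.mul_apply]
  rw [mul_add, Real.exp_add, Real.exp_add, ENNReal.ofReal_mul (by positivity),
    ENNReal.ofReal_mul (by positivity)]
  ring

lemma integral_exponent_rotGaussian {a A b : ℝ≥0} (ha : a ≠ 0) (hA : A ≠ 0) :
    ∫ z, 1 / (2 * a / (a + b)) * (gaussianLogRatio (A + b) (a + b) z.1 +
          gaussianLogRatio (A + b) (a + b) z.2) +
        gaussianLogRatio a A ((z.1 + z.2) / 2) ∂rotGaussian A b =
      (a + b) / (2 * a) * Real.log ((a + b) / (A + b)) + 1 / 2 * Real.log (A / a) := by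
  have h1 := integrable_gaussianLogRatio (A + b) (a + b) (A + b)
  have i1 : Integrable (fun z : ℝ × ℝ => gaussianLogRatio (A + b) (a + b) z.1)
      (rotGaussian A b) := by
    rw [← map_fst_rotGaussian] at h1
    exact h1.comp_measurable measurable_fst
  have i2 : Integrable (fun z : ℝ × ℝ => gaussianLogRatio (A + b) (a + b) z.2)
      (rotGaussian A b) := by
    have h1 := integrable_gaussianLogRatio (A + b) (a + b) (A + b)
    rw [← map_snd_rotGaussian] at h1
    exact h1.comp_measurable measurable_snd
  have j1 : ∫ z : ℝ × ℝ, gaussianLogRatio (A + b) (a + b) z.1 ∂rotGaussian A b =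
      ∫ x, gaussianLogRatio (A + b) (a + b) x ∂gaussianReal 0 (A + b) := by
    rw [← map_fst_rotGaussian, integral_map (by fun_prop)
      (Measurable.aestronglyMeasurable (by fun_prop))]
  have j2 : ∫ z : ℝ × ℝ, gaussianLogRatio (A + b) (a + b) z.2 ∂rotGaussian A b =
      ∫ x, gaussianLogRatio (A + b) (a + b) x ∂gaussianReal 0 (A + b) := by
    rw [← map_snd_rotGaussian, integral_map (by fun_prop)
      (Measurable.aestronglyMeasurable (by fun_prop))]
  have i12 : Integrable (fun z : ℝ × ℝ => 1 / (2 * a / (a + b) : ℝ) *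
      (gaussianLogRatio (A + b) (a + b) z.1 + gaussianLogRatio (A + b) (a + b) z.2))
      (rotGaussian A b) := (i1.add i2).const_mul _
  rw [integral_add i12 (integrable_gaussianLogRatio_rotGaussian _ _ _ _),
    integral_const_mul, integral_add i1 i2, j1, j2, integral_gaussianLogRatio,
    integral_gaussianLogRatio_rotGaussian]
  have ha' : (0 : ℝ) < a := by positivity
  have hA' : (0 : ℝ) < A := by positivity
  push_cast
  field_simp
  ring

lemma integrable_exponent_rotGaussian (a A b : ℝ≥0) (c : ℝ) :
    Integrable (fun z : ℝ × ℝ => c * (gaussianLogRatio (A + b) (a + b) z.1 +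
          gaussianLogRatio (A + b) (a + b) z.2) +
        gaussianLogRatio a A ((z.1 + z.2) / 2)) (rotGaussian A b) := by
  have h1 := integrable_gaussianLogRatio (A + b) (a + b) (A + b)
  have h2 := h1
  rw [← map_fst_rotGaussian] at h1
  rw [← map_snd_rotGaussian] at h2
  exact (((h1.comp_measurable measurable_fst).add
    (h2.comp_measurable measurable_snd)).const_mul _).add
      (integrable_gaussianLogRatio_rotGaussian _ _ _ _)

variable {E F : Type*} [MeasurableSpace E] [MeasurableSpace F]

lemma ofReal_exp_llr_ae_eq {μ ν : Measure E} [SigmaFinite μ] [SigmaFinite ν] (h : μ ≪ ν) :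
    (fun x => ENNReal.ofReal (exp (llr μ ν x))) =ᵐ[μ] μ.rnDeriv ν := by
  filter_upwards [exp_llr_of_ac μ ν h, h.ae_le (Measure.rnDeriv_ne_top μ ν)] with x hx hx'
  rw [hx, ENNReal.ofReal_toReal hx']

/-- A variational lower bound for the relative entropy. -/
lemma integral_le_integral_llr {μ ν : Measure E} [IsProbabilityMeasure μ] [SigmaFinite ν]
    (hac : μ ≪ ν) (hllr : Integrable (llr μ ν) μ) {T : E → ℝ≥0∞} (hT : Measurable T)
    (hT1 : ∫⁻ x, T x ∂ν ≤ 1) {h : E → ℝ} (hh : Integrable h μ)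
    (hTh : T =ᵐ[μ] fun x => ENNReal.ofReal (exp (h x))) :
    ∫ x, h x ∂μ ≤ ∫ x, llr μ ν x ∂μ := by
  have hm : AEStronglyMeasurable (fun x => exp (h x - llr μ ν x)) μ :=
    Real.continuous_exp.comp_aestronglyMeasurable (hh.sub hllr).1
  have hle : ∫⁻ x, ENNReal.ofReal (exp (h x - llr μ ν x)) ∂μ ≤ 1 := by
    calc ∫⁻ x, ENNReal.ofReal (exp (h x - llr μ ν x)) ∂μ
        = ∫⁻ x, T x / μ.rnDeriv ν x ∂μ := by
          refine lintegral_congr_ae ?_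
          filter_upwards [hTh, ofReal_exp_llr_ae_eq hac] with x h1 h2
          rw [h1, ← h2, Real.exp_sub, ENNReal.ofReal_div_of_pos (exp_pos _)]
      _ = ∫⁻ x, μ.rnDeriv ν x * (T x / μ.rnDeriv ν x) ∂ν :=
          (lintegral_rnDeriv_mul hac (hT.div (Measure.measurable_rnDeriv _ _)).aemeasurable).symm
      _ ≤ ∫⁻ x, T x ∂ν := lintegral_mono fun x => ENNReal.mul_div_le
      _ ≤ 1 := hT1
  have hi : Integrable (fun x => exp (h x - llr μ ν x)) μ :=
    (lintegral_ofReal_ne_top_iff_integrable hm (Eventually.of_forall fun x => (exp_pos _).le)).1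
      (hle.trans_lt ENNReal.one_lt_top).ne
  have hle' : ∫ x, exp (h x - llr μ ν x) ∂μ ≤ 1 := by
    rw [integral_eq_lintegral_of_nonneg_ae (Eventually.of_forall fun x => (exp_pos _).le) hm]
    exact ENNReal.toReal_le_of_le_ofReal zero_le_one (by simpa using hle)
  have h3 : ∫ x, (h x - llr μ ν x) ∂μ ≤ ∫ x, (exp (h x - llr μ ν x) - 1) ∂μ :=
    integral_mono (hh.sub hllr) (hi.sub (integrable_const _)) fun x => by
      have := Real.add_one_le_exp (h x - llr μ ν x)
      dsimp only
      linarith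
  rw [integral_sub hh hllr, integral_sub hi (integrable_const _)] at h3
  simp only [integral_const, probReal_univ, smul_eq_mul, mul_one] at h3
  linarith

lemma ae_lintegral_rnDeriv_eq_one {σ : Measure (E × F)} [IsProbabilityMeasure σ]
    (hac : σ ≪ (σ.map Prod.fst).prod (σ.map Prod.snd)) :
    ∀ᵐ w ∂σ.map Prod.snd,
      ∫⁻ x, σ.rnDeriv ((σ.map Prod.fst).prod (σ.map Prod.snd)) (x, w) ∂σ.map Prod.fst = 1 := by
  have := isProbabilityMeasure_map_fst σ
  have := isProbabilityMeasure_map_snd σ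
  have hm := Measure.measurable_rnDeriv σ ((σ.map Prod.fst).prod (σ.map Prod.snd))
  refine ae_eq_of_forall_setLIntegral_eq_of_sigmaFinite (g := fun _ => (1 : ℝ≥0∞))
    hm.lintegral_prod_left' measurable_const fun s hs _ => ?_
  have h1 : ∫⁻ z in Prod.snd ⁻¹' s,
      σ.rnDeriv ((σ.map Prod.fst).prod (σ.map Prod.snd)) z
        ∂(σ.map Prod.fst).prod (σ.map Prod.snd) = σ (Prod.snd ⁻¹' s) := by
    rw [Measure.setLIntegral_rnDeriv hac]
  rw [setLIntegral_const, one_mul, Measure.map_apply measurable_snd hs, ← h1,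
    ← univ_prod, ← Measure.prod_restrict, Measure.restrict_univ, lintegral_prod_symm' _ hm]

/-- Entropic form of a weighted hypercontractive inequality. -/
theorem integral_add_mutInfo_le_mutInfo {p : ℝ} (hp : 0 < p) {ν : Measure ((ℝ × ℝ) × ℝ)}
    [IsProbabilityMeasure ν] {q : ℝ × ℝ → ℝ} (hq : Measurable q)
    (hqi : Integrable q (ν.map Prod.fst))
    (hHC : ∀ F G : ℝ → ℝ≥0∞, Measurable F → Measurable G →
      ∫⁻ z, F z.1 * G z.2 * ENNReal.ofReal (exp (q z)) ∂ν.map Prod.fst ≤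
        (∫⁻ z, F z.1 ^ p ∂ν.map Prod.fst) ^ (1 / p) * (∫⁻ z, G z.2 ^ p ∂ν.map Prod.fst) ^ (1 / p))
    (hfin : mutInfo ν ≠ ∞) :
    ∫ z, q z ∂ν.map Prod.fst + 1 / p * ((mutInfo (ν.map fun z => (z.1.1, z.2))).toReal +
      (mutInfo (ν.map fun z => (z.1.2, z.2))).toReal) ≤ (mutInfo ν).toReal := by
  have m1 : Measurable fun z : (ℝ × ℝ) × ℝ => (z.1.1, z.2) := by fun_prop
  have m2 : Measurable fun z : (ℝ × ℝ) × ℝ => (z.1.2, z.2) := by fun_prop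
  set κ := ν.map Prod.fst with hκ
  set ω := ν.map Prod.snd with hω
  set ν₁ := ν.map fun z => (z.1.1, z.2) with hν₁
  set ν₂ := ν.map fun z => (z.1.2, z.2) with hν₂
  have : IsProbabilityMeasure κ := isProbabilityMeasure_map_fst ν
  have : IsProbabilityMeasure ω := isProbabilityMeasure_map_snd ν
  have : IsProbabilityMeasure ν₁ := Measure.isProbabilityMeasure_map m1.aemeasurable
  have : IsProbabilityMeasure ν₂ := Measure.isProbabilityMeasure_map m2.aemeasurable
  have := isProbabilityMeasure_map_fst ν₁
  have := isProbabilityMeasure_map_fst ν₂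
  have hs1 : ν₁.map Prod.snd = ω := Measure.map_map measurable_snd m1
  have hs2 : ν₂.map Prod.snd = ω := Measure.map_map measurable_snd m2
  have hf1 : ν₁.map Prod.fst = κ.map Prod.fst := by
    rw [hν₁, hκ, Measure.map_map measurable_fst m1, Measure.map_map measurable_fst measurable_fst]
    rfl
  have hf2 : ν₂.map Prod.fst = κ.map Prod.snd := by
    rw [hν₂, hκ, Measure.map_map measurable_fst m2, Measure.map_map measurable_snd measurable_fst]
    rfl
  have hfin1 : mutInfo ν₁ ≠ ∞ :=
    ((mutInfo_map_prodMap_le ν measurable_fst measurable_id).trans_lt hfin.lt_top).ne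
  have hfin2 : mutInfo ν₂ ≠ ∞ :=
    ((mutInfo_map_prodMap_le ν measurable_snd measurable_id).trans_lt hfin.lt_top).ne
  have hprob : ∀ {X Y : Type} [MeasurableSpace X] [MeasurableSpace Y] (τ : Measure (X × Y))
      [IsProbabilityMeasure τ], mutInfo τ ≠ ∞ →
        τ ≪ (τ.map Prod.fst).prod (τ.map Prod.snd) ∧
        Integrable (llr τ ((τ.map Prod.fst).prod (τ.map Prod.snd))) τ ∧
        (mutInfo τ).toReal = ∫ z, llr τ ((τ.map Prod.fst).prod (τ.map Prod.snd)) z ∂τ := by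
    intro X Y _ _ τ _ h
    have := isProbabilityMeasure_map_fst τ
    have := isProbabilityMeasure_map_snd τ
    obtain ⟨h1, h2⟩ := klDiv_ne_top_iff.1 h
    exact ⟨h1, h2, toReal_klDiv_of_measure_eq h1 (by simp)⟩
  obtain ⟨hac, hi, hI⟩ := hprob ν hfin
  obtain ⟨hac1, hi1, hI1⟩ := hprob ν₁ hfin1
  obtain ⟨hac2, hi2, hI2⟩ := hprob ν₂ hfin2
  have hone1 := ae_lintegral_rnDeriv_eq_one hac1
  have hone2 := ae_lintegral_rnDeriv_eq_one hac2
  have hexp1 := ofReal_exp_llr_ae_eq hac1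
  have hexp2 := ofReal_exp_llr_ae_eq hac2
  rw [← hκ, ← hω] at hac hi hI
  set f := ν₁.rnDeriv ((ν₁.map Prod.fst).prod (ν₁.map Prod.snd))
  set g := ν₂.rnDeriv ((ν₂.map Prod.fst).prod (ν₂.map Prod.snd))
  set l₁ := llr ν₁ ((ν₁.map Prod.fst).prod (ν₁.map Prod.snd))
  set l₂ := llr ν₂ ((ν₂.map Prod.fst).prod (ν₂.map Prod.snd))
  have hfm : Measurable f := Measure.measurable_rnDeriv _ _
  have hgm : Measurable g := Measure.measurable_rnDeriv _ _
  rw [hs1, hf1] at hone1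
  rw [hs2, hf2] at hone2
  have hTm : Measurable fun z : (ℝ × ℝ) × ℝ => f (z.1.1, z.2) ^ (1 / p) * g (z.1.2, z.2) ^ (1 / p) *
      ENNReal.ofReal (exp (q z.1)) := by fun_prop
  have hT1 : ∫⁻ z, f (z.1.1, z.2) ^ (1 / p) * g (z.1.2, z.2) ^ (1 / p) *
      ENNReal.ofReal (exp (q z.1)) ∂κ.prod ω ≤ 1 := by
    rw [lintegral_prod_symm' _ hTm]
    calc ∫⁻ w, ∫⁻ z, f (z.1, w) ^ (1 / p) * g (z.2, w) ^ (1 / p) *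
          ENNReal.ofReal (exp (q z)) ∂κ ∂ω
        ≤ ∫⁻ w, 1 ∂ω := by
          refine lintegral_mono_ae ?_
          filter_upwards [hone1, hone2] with w h1 h2
          have h := hHC (fun x => f (x, w) ^ (1 / p)) (fun x => g (x, w) ^ (1 / p))
            (by fun_prop) (by fun_prop)
          simp only [← ENNReal.rpow_mul, one_div_mul_cancel hp.ne', ENNReal.rpow_one] at h
          rw [lintegral_map (by fun_prop) measurable_fst] at h1
          rw [lintegral_map (by fun_prop) measurable_snd] at h2
          rw [h1, h2] at h
          simpa using h
      _ = 1 := by simp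
  have hqi' : Integrable (fun z : (ℝ × ℝ) × ℝ => q z.1) ν := hqi.comp_measurable measurable_fst
  have hi1' : Integrable (fun z : (ℝ × ℝ) × ℝ => l₁ (z.1.1, z.2)) ν := hi1.comp_measurable m1
  have hi2' : Integrable (fun z : (ℝ × ℝ) × ℝ => l₂ (z.1.2, z.2)) ν := hi2.comp_measurable m2
  have hi12 : Integrable (fun z : (ℝ × ℝ) × ℝ =>
      1 / p * (l₁ (z.1.1, z.2) + l₂ (z.1.2, z.2))) ν := (hi1'.add hi2').const_mul _
  have hroot : ∀ x : ℝ, ENNReal.ofReal (exp x) ^ (1 / p) = ENNReal.ofReal (exp (1 / p * x)) := by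
    intro x
    rw [ENNReal.ofReal_rpow_of_pos (exp_pos _), ← Real.exp_mul, mul_comm]
  have key := integral_le_integral_llr hac hi hTm hT1
    (h := fun z => q z.1 + 1 / p * (l₁ (z.1.1, z.2) + l₂ (z.1.2, z.2)))
    (hqi'.add hi12) (by
      filter_upwards [ae_of_ae_map m1.aemeasurable hexp1, ae_of_ae_map m2.aemeasurable hexp2]
        with z h1 h2
      rw [← h1, ← h2, hroot, hroot, mul_add, Real.exp_add, Real.exp_add,
        ENNReal.ofReal_mul (by positivity), ENNReal.ofReal_mul (by positivity)]
      ring)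
  rw [integral_add hqi' hi12, integral_const_mul,
    integral_add hi1' hi2'] at key
  rw [hI, hI1, hI2]
  have e0 : ∫ z, q z ∂κ = ∫ z, q z.1 ∂ν :=
    integral_map measurable_fst.aemeasurable hq.aestronglyMeasurable
  have e1 : ∫ z, l₁ z ∂ν₁ = ∫ z, l₁ (z.1.1, z.2) ∂ν := integral_map m1.aemeasurable hi1.1
  have e2 : ∫ z, l₂ z ∂ν₂ = ∫ z, l₂ (z.1.2, z.2) ∂ν := integral_map m2.aemeasurable hi2.1
  rw [e0, e1, e2]
  exact key

end EntropyInequality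

section Converse

/-- The law of a standard Gaussian pair with correlation `ρ`. -/
noncomputable def stdGaussianPair (ρ : ℝ) : Measure (ℝ × ℝ) :=
  rotGaussian ((1 + ρ) / 2).toNNReal ((1 - ρ) / 2).toNNReal

instance (ρ : ℝ) : IsProbabilityMeasure (stdGaussianPair ρ) := by
  unfold stdGaussianPair; infer_instance

lemma map_linearCombination_stdGaussianPair {ρ : ℝ} (h0 : -1 ≤ ρ) (h1 : ρ ≤ 1) (c d : ℝ) :
    (stdGaussianPair ρ).map (fun p => c * p.1 + d * p.2) =
      gaussianReal 0 (c ^ 2 + d ^ 2 + 2 * c * d * ρ).toNNReal := by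
  rw [stdGaussianPair, map_linearCombination_rotGaussian, Real.coe_toNNReal _ (by linarith),
    Real.coe_toNNReal _ (by linarith)]
  congr 2
  ring

lemma mutInfo_stdGaussianPair {ρ : ℝ} (h0 : -1 < ρ) (h1 : ρ < 1) :
    mutInfo (stdGaussianPair ρ) = ENNReal.ofReal (-(1 / 2) * Real.log (1 - ρ ^ 2)) := by
  rw [stdGaussianPair, mutInfo_rotGaussian, Real.coe_toNNReal _ (by linarith),
    Real.coe_toNNReal _ (by linarith)]
  · congr 3
    ring
  · exact (Real.toNNReal_pos.2 (by linarith)).ne'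
  · exact (Real.toNNReal_pos.2 (by linarith)).ne'
  · rw [← Real.toNNReal_add (by linarith) (by linarith)]
    norm_num
    ring_nf

lemma log_one_sub_sq_nonpos {r : ℝ} (h0 : -1 < r) (h1 : r < 1) : Real.log (1 - r ^ 2) ≤ 0 :=
  Real.log_nonpos (by nlinarith) (by nlinarith)

lemma log_ratio_le_mutInfo {ρ r γ : ℝ} (hr0 : 0 < r) (hrρ : r < ρ) (hρ1 : ρ < 1)
    (hγ0 : 0 ≤ γ) (hγ : γ ≤ -(1 / 2) * Real.log (1 - r ^ 2)) {ν : Measure ((ℝ × ℝ) × ℝ)}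
    [IsProbabilityMeasure ν] (hν : ν.map Prod.fst = stdGaussianPair ρ) (hfin : mutInfo ν ≠ ∞)
    (hcon : mutInfo (ν.map fun p => (p.1.1, (p.1.2, p.2))) ≤
      mutInfo (ν.map fun p => (p.1.1, p.2)) + ENNReal.ofReal γ) :
    1 / 2 * Real.log ((1 + ρ) * (1 - r) / ((1 - ρ) * (1 + r))) ≤ (mutInfo ν).toReal := by
  have hr1 : 0 < 1 - r := by linarith
  have hρ1' : 0 < 1 - ρ := by linarith
  have hρ0 : 0 < 1 + ρ := by linarith
  have hr0' : 0 < 1 + r := by linarith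
  obtain ⟨A, hA⟩ : ∃ A : ℝ≥0, A = ((1 + ρ) / 2).toNNReal := ⟨_, rfl⟩
  obtain ⟨b, hb⟩ : ∃ b : ℝ≥0, b = ((1 - ρ) / 2).toNNReal := ⟨_, rfl⟩
  obtain ⟨a, ha⟩ : ∃ a : ℝ≥0, a = ((1 - ρ) * (1 + r) / (2 * (1 - r))).toNNReal := ⟨_, rfl⟩
  have hA' : (A : ℝ) = (1 + ρ) / 2 := by rw [hA, Real.coe_toNNReal _ (by positivity)]
  have hb' : (b : ℝ) = (1 - ρ) / 2 := by rw [hb, Real.coe_toNNReal _ (by positivity)]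
  have ha' : (a : ℝ) = (1 - ρ) * (1 + r) / (2 * (1 - r)) := by
    rw [ha, Real.coe_toNNReal _ (by positivity)]
  have hν' : ν.map Prod.fst = rotGaussian A b := by rw [hν, stdGaussianPair, hA, hb]
  have hb0 : 0 < b := by rw [hb]; exact Real.toNNReal_pos.2 (by positivity)
  have hA0 : A ≠ 0 := by rw [hA]; exact (Real.toNNReal_pos.2 (by positivity)).ne'
  have hba : b < a := by
    rw [← NNReal.coe_lt_coe, hb', ha', div_lt_div_iff₀ (by norm_num) (by positivity)]
    nlinarith [mul_pos hρ1' hr0]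
  have hp : (2 * a / (a + b) : ℝ) = 1 + r := by
    rw [ha', hb']
    field_simp
    ring
  have hq := integrable_exponent_rotGaussian a A b (1 / (2 * a / (a + b)))
  have hmain := integral_add_mutInfo_le_mutInfo (p := 2 * a / (a + b)) (by rw [hp]; linarith)
    (ν := ν) (q := fun z => 1 / (2 * a / (a + b)) * (gaussianLogRatio (A + b) (a + b) z.1 +
          gaussianLogRatio (A + b) (a + b) z.2) + gaussianLogRatio a A ((z.1 + z.2) / 2))
    (by fun_prop) (by rw [hν']; exact hq)
    (fun F G hF hG => by rw [hν']; exact lintegral_mul_exp_le_rotGaussian hb0 hba hA0 hF hG) hfin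
  rw [hν', integral_exponent_rotGaussian (hb0.trans hba).ne' hA0, hp] at hmain
  have hchain := mutInfo_chain ν
  rw [hν, mutInfo_stdGaussianPair (by linarith) hρ1] at hchain
  have hfin1 : mutInfo (ν.map fun z => (z.1.1, z.2)) ≠ ∞ :=
    ((mutInfo_map_prodMap_le ν measurable_fst measurable_id).trans_lt hfin.lt_top).ne
  have hfin2 : mutInfo (ν.map fun z => (z.1.2, z.2)) ≠ ∞ :=
    ((mutInfo_map_prodMap_le ν measurable_snd measurable_id).trans_lt hfin.lt_top).ne
  have hreal : -(1 / 2) * Real.log (1 - ρ ^ 2) + (mutInfo ν).toReal ≤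
      (mutInfo (ν.map fun z => (z.1.2, z.2))).toReal +
        ((mutInfo (ν.map fun z => (z.1.1, z.2))).toReal + γ) := by
    have h := hchain.le.trans (add_le_add_right hcon _)
    have hl := log_one_sub_sq_nonpos (by linarith) hρ1
    have h' := ENNReal.toReal_mono (by simp [hfin1, hfin2]) h
    rwa [ENNReal.toReal_add ENNReal.ofReal_ne_top hfin, ENNReal.toReal_add hfin2 (by simp [hfin1]),
      ENNReal.toReal_add hfin1 ENNReal.ofReal_ne_top, ENNReal.toReal_ofReal (by linarith),
      ENNReal.toReal_ofReal hγ0] at h'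
  have hs : (a + b : ℝ) / (A + b) = (1 - ρ) / (1 - r) := by
    rw [ha', hb', hA']
    field_simp
    ring
  have hAa : (A : ℝ) / a = (1 + ρ) * (1 - r) / ((1 - ρ) * (1 + r)) := by
    rw [ha', hA']
    field_simp
  have hp' : (a + b : ℝ) / (2 * a) = 1 / (1 + r) := by rw [← hp, one_div_div]
  rw [hs, hAa, hp'] at hmain
  have e1 : Real.log ((1 - ρ) / (1 - r)) = Real.log (1 - ρ) - Real.log (1 - r) :=
    Real.log_div hρ1'.ne' hr1.ne'
  have e2 : Real.log ((1 + ρ) * (1 - r) / ((1 - ρ) * (1 + r))) =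
      Real.log (1 + ρ) + Real.log (1 - r) - (Real.log (1 - ρ) + Real.log (1 + r)) := by
    rw [Real.log_div (by positivity) (by positivity), Real.log_mul hρ0.ne' hr1.ne',
      Real.log_mul hρ1'.ne' hr0'.ne']
  have e3 : ∀ x : ℝ, 0 < 1 + x → 0 < 1 - x →
      Real.log (1 - x ^ 2) = Real.log (1 + x) + Real.log (1 - x) := by
    intro x h1 h2
    rw [← Real.log_mul h1.ne' h2.ne']
    congr 1
    ring
  rw [e3 ρ hρ0 hρ1'] at hreal
  rw [e3 r hr0' hr1] at hγ
  rw [e1, e2] at hmain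
  rw [e2]
  set I := (mutInfo ν).toReal
  set m := (mutInfo (ν.map fun z => (z.1.1, z.2))).toReal
  set m' := (mutInfo (ν.map fun z => (z.1.2, z.2))).toReal
  have hmain' := mul_le_mul_of_nonneg_left hmain hr0'.le
  have hl : (1 + r) * (1 / (1 + r) * (Real.log (1 - ρ) - Real.log (1 - r)) +
      1 / 2 * (Real.log (1 + ρ) + Real.log (1 - r) - (Real.log (1 - ρ) + Real.log (1 + r))) +
      1 / (1 + r) * (m + m')) = (Real.log (1 - ρ) - Real.log (1 - r)) +
      (1 + r) * (1 / 2 * (Real.log (1 + ρ) + Real.log (1 - r) -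
        (Real.log (1 - ρ) + Real.log (1 + r)))) + (m + m') := by
    field_simp
  rw [hl] at hmain'
  refine le_of_mul_le_mul_left ?_ hr0
  nlinarith

lemma max_log_ratio_le_mutInfo {ρ γ : ℝ} (hρ0 : 0 ≤ ρ) (hρ1 : ρ < 1) (hγ0 : 0 ≤ γ)
    {ν : Measure ((ℝ × ℝ) × ℝ)} [IsProbabilityMeasure ν]
    (hν : ν.map Prod.fst = stdGaussianPair ρ) (hfin : mutInfo ν ≠ ∞)
    (hcon : mutInfo (ν.map fun p => (p.1.1, (p.1.2, p.2))) ≤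
      mutInfo (ν.map fun p => (p.1.1, p.2)) + ENNReal.ofReal γ) :
    1 / 2 * max (Real.log ((1 + ρ) * (1 - √(1 - exp (-2 * γ))) /
      ((1 - ρ) * (1 + √(1 - exp (-2 * γ)))))) 0 ≤ (mutInfo ν).toReal := by
  have hexp : exp (-2 * γ) ≤ 1 := Real.exp_le_one_iff.2 (by linarith)
  have hsq : √(1 - exp (-2 * γ)) ^ 2 = 1 - exp (-2 * γ) := Real.sq_sqrt (by linarith)
  have h0 := Real.sqrt_nonneg (1 - exp (-2 * γ))
  set r₀ := √(1 - exp (-2 * γ))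
  have h1 : r₀ < 1 := by nlinarith [exp_pos (-2 * γ)]
  have hI : 0 ≤ (mutInfo ν).toReal := ENNReal.toReal_nonneg
  rw [mul_max_of_nonneg _ _ (by norm_num), mul_zero]
  refine max_le ?_ hI
  rcases le_or_gt ρ r₀ with h | h
  · refine le_trans ?_ hI
    have : (1 + ρ) * (1 - r₀) / ((1 - ρ) * (1 + r₀)) ≤ 1 := by
      rw [div_le_one (mul_pos (by linarith) (by linarith))]
      nlinarith
    have := Real.log_nonpos (div_nonneg (mul_nonneg (by linarith) (by linarith))
      (mul_nonneg (by linarith) (by linarith))) this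
    linarith
  · have hc : ContinuousAt (fun r => 1 / 2 * Real.log ((1 + ρ) * (1 - r) / ((1 - ρ) * (1 + r))))
        r₀ := by
      have h2 : (1 - ρ) * (1 + r₀) ≠ 0 := (mul_pos (by linarith) (by linarith)).ne'
      have h3 : (1 + ρ) * (1 - r₀) / ((1 - ρ) * (1 + r₀)) ≠ 0 :=
        div_ne_zero (mul_pos (by linarith) (by linarith)).ne' h2
      fun_prop (disch := assumption)
    refine le_of_tendsto (hc.tendsto.mono_left (nhdsWithin_le_nhds (s := Ioi r₀))) ?_
    filter_upwards [Ioo_mem_nhdsGT h] with r hr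
    refine log_ratio_le_mutInfo (h0.trans_lt hr.1) hr.2 hρ1 hγ0 ?_ hν hfin hcon
    have h4 : 1 - r ^ 2 ≤ exp (-2 * γ) := by nlinarith [hr.1]
    have h5 := Real.log_le_log (by nlinarith [hr.2, hr.1]) h4
    rw [Real.log_exp] at h5
    linarith

end Converse

section Achievability

lemma map_linearCombination_stdGaussianPair_prod {β : ℝ} (h0 : -1 ≤ β) (h1 : β ≤ 1)
    (x y z : ℝ) :
    ((stdGaussianPair β).prod (gaussianReal 0 1)).map
        (fun t => x * t.1.1 + y * t.1.2 + z * t.2) =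
      gaussianReal 0 (x ^ 2 + y ^ 2 + 2 * x * y * β + z ^ 2).toNNReal := by
  have hm : Measurable fun p : ℝ × ℝ => x * p.1 + y * p.2 := by fun_prop
  have hm' : Measurable fun p : ℝ × ℝ => 1 * p.1 + z * p.2 := by fun_prop
  have hq : 0 ≤ x ^ 2 + y ^ 2 + 2 * x * y * β := by
    nlinarith [mul_nonneg (sub_nonneg.2 h1) (sq_nonneg (x - y)),
      mul_nonneg (by linarith : 0 ≤ 1 + β) (sq_nonneg (x + y))]
  have h := Measure.map_prod_map (stdGaussianPair β) (gaussianReal 0 1) hm measurable_id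
  rw [map_linearCombination_stdGaussianPair h0 h1, Measure.map_id] at h
  have h2 := map_linearCombination_prod_gaussianReal (x ^ 2 + y ^ 2 + 2 * x * y * β).toNNReal 1 1 z
  rw [h, Measure.map_map hm' (hm.prodMap measurable_id), Real.coe_toNNReal _ hq] at h2
  convert h2 using 2
  · ext t
    simp
  · congr 1
    simp

/-- Adding independent noise to one component does not increase mutual information. -/
lemma mutInfo_map_noise_le {E F G H : Type*} [MeasurableSpace E] [MeasurableSpace F]
    [MeasurableSpace G] [MeasurableSpace H] [StandardBorelSpace G] [Nonempty G]
    (Q : Measure (E × F)) [IsProbabilityMeasure Q] (N : Measure G) [IsProbabilityMeasure N]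
    {h : E × G → H} (hh : Measurable h) :
    mutInfo ((Q.prod N).map fun t => (h (t.1.1, t.2), t.1.2)) ≤ mutInfo Q := by
  have := isProbabilityMeasure_map_fst Q
  have := isProbabilityMeasure_map_snd Q
  have hT : Measurable fun t : (E × F) × G => (h (t.1.1, t.2), t.1.2) := by fun_prop
  have hR : Measurable fun t : (E × F) × G => ((t.1.1, t.2), t.1.2) := by fun_prop
  have hrearr : (((Q.map Prod.fst).prod (Q.map Prod.snd)).prod N).map
      (fun t => ((t.1.1, t.2), t.1.2)) = ((Q.map Prod.fst).prod N).prod (Q.map Prod.snd) := by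
    refine Measure.ext_of_lintegral _ fun f hf => ?_
    rw [lintegral_map hf hR, lintegral_prod _ (by fun_prop), lintegral_prod _ (by fun_prop),
      lintegral_prod _ hf.aemeasurable, lintegral_prod _ (by fun_prop)]
    refine lintegral_congr fun u => ?_
    exact lintegral_lintegral_swap (f := fun w v => f ((u, v), w)) (by fun_prop)
  have hle := klDiv_map_le (Q.prod N) (((Q.map Prod.fst).prod (Q.map Prod.snd)).prod N) hT
  rw [klDiv_prod_prod, klDiv_self, add_zero] at hle
  have hprod : (((Q.map Prod.fst).prod (Q.map Prod.snd)).prod N).map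
      (fun t => (h (t.1.1, t.2), t.1.2)) =
      (((Q.map Prod.fst).prod N).map h).prod (Q.map Prod.snd) := by
    have h2 := Measure.map_prod_map ((Q.map Prod.fst).prod N) (Q.map Prod.snd) hh measurable_id
    rw [Measure.map_id] at h2
    rw [h2, ← hrearr, Measure.map_map (hh.prodMap measurable_id) hR]
    rfl
  have hfst : (Q.prod N).map (fun t => h (t.1.1, t.2)) = ((Q.map Prod.fst).prod N).map h := by
    have h2 := Measure.map_prod_map Q N measurable_fst measurable_id
    rw [Measure.map_id] at h2
    rw [h2, Measure.map_map hh (measurable_fst.prodMap measurable_id)]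
    rfl
  have hsnd : (Q.prod N).map (fun t => t.1.2) = Q.map Prod.snd := by
    have h2 := Measure.map_map (μ := Q.prod N) measurable_snd measurable_fst
    rw [Measure.map_fst_prod, measure_univ, one_smul] at h2
    exact h2.symm
  rw [mutInfo, Measure.map_map measurable_fst hT, Measure.map_map measurable_snd hT]
  rw [hprod, ← hfst] at hle
  change klDiv _ ((Measure.map (fun t : (E × F) × G => h (t.1.1, t.2)) _).prod
    (Measure.map (fun t : (E × F) × G => t.1.2) _)) ≤ _
  rwa [hsnd]

lemma exists_mutInfo_eq_zero {ρ r γ : ℝ} (hρ0 : 0 ≤ ρ) (hρ1 : ρ < 1) (hρr : ρ ≤ r) (hr1 : r < 1)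
    (hγ : γ = -(1 / 2) * Real.log (1 - r ^ 2)) :
    ∃ ν : Measure ((ℝ × ℝ) × ℝ), ∃ _ : IsProbabilityMeasure ν,
      ν.map Prod.fst = stdGaussianPair ρ ∧
      mutInfo (ν.map fun p => (p.1.1, (p.1.2, p.2))) ≤
        mutInfo (ν.map fun p => (p.1.1, p.2)) + ENNReal.ofReal γ ∧ mutInfo ν = 0 := by
  have hfst : ((stdGaussianPair ρ).prod (Measure.dirac (0 : ℝ))).map Prod.fst
      = stdGaussianPair ρ := by
    rw [Measure.map_fst_prod, measure_univ, one_smul]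
  have hzero : mutInfo ((stdGaussianPair ρ).prod (Measure.dirac (0 : ℝ))) = 0 := by
    rw [mutInfo, hfst, Measure.map_snd_prod, measure_univ, one_smul, klDiv_self]
  refine ⟨(stdGaussianPair ρ).prod (Measure.dirac 0), inferInstance, hfst, ?_, hzero⟩
  have hchain := mutInfo_chain ((stdGaussianPair ρ).prod (Measure.dirac (0 : ℝ)))
  rw [hfst, hzero, add_zero, mutInfo_stdGaussianPair (by linarith) hρ1] at hchain
  calc _ ≤ ENNReal.ofReal (-(1 / 2) * Real.log (1 - ρ ^ 2)) := by
        rw [hchain]; exact le_add_self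
    _ ≤ ENNReal.ofReal γ := by
        refine ENNReal.ofReal_le_ofReal ?_
        have := Real.log_le_log (by nlinarith : 0 < 1 - r ^ 2)
          (by nlinarith : 1 - r ^ 2 ≤ 1 - ρ ^ 2)
        linarith
    _ ≤ _ := le_add_self

lemma exists_mutInfo_le {ρ r γ : ℝ} (hr0 : 0 ≤ r) (hrρ : r < ρ) (hρ1 : ρ < 1)
    (hγ : γ = -(1 / 2) * Real.log (1 - r ^ 2)) :
    ∃ ν : Measure ((ℝ × ℝ) × ℝ), ∃ _ : IsProbabilityMeasure ν,
      ν.map Prod.fst = stdGaussianPair ρ ∧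
      mutInfo (ν.map fun p => (p.1.1, (p.1.2, p.2))) ≤
        mutInfo (ν.map fun p => (p.1.1, p.2)) + ENNReal.ofReal γ ∧
      mutInfo ν ≤
        ENNReal.ofReal (1 / 2 * Real.log ((1 + ρ) * (1 - r) / ((1 - ρ) * (1 + r)))) := by
  have hr1 : 0 < 1 - r := by linarith
  have hr0' : 0 < 1 + r := by linarith
  have hρ1' : 0 < 1 - ρ := by linarith
  have hρ0 : 0 < 1 + ρ := by linarith
  obtain ⟨s, hs⟩ : ∃ s : ℝ, s = (1 - ρ) / (1 - r) := ⟨_, rfl⟩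
  have hs0 : 0 < s := by rw [hs]; positivity
  have hs1 : s < 1 := by rw [hs, div_lt_one hr1]; linarith
  obtain ⟨α, hα0, hα⟩ : ∃ α : ℝ, 0 ≤ α ∧ α ^ 2 = 1 - s :=
    ⟨√(1 - s), Real.sqrt_nonneg _, Real.sq_sqrt (by linarith)⟩
  obtain ⟨A, hA0, hA⟩ : ∃ A : ℝ, 0 < A ∧ A ^ 2 = (1 + ρ) / 2 :=
    ⟨√((1 + ρ) / 2), Real.sqrt_pos.2 (by linarith), Real.sq_sqrt (by linarith)⟩
  obtain ⟨b, hb⟩ : ∃ b : ℝ, b ^ 2 = (1 - ρ) / 2 :=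
    ⟨√((1 - ρ) / 2), Real.sq_sqrt (by linarith)⟩
  obtain ⟨β, hβ⟩ : ∃ β : ℝ, β = α / A := ⟨_, rfl⟩
  have hAβ : A * β = α := by rw [hβ]; field_simp
  have hβ0 : 0 ≤ β := by rw [hβ]; positivity
  have hβsq : 1 - β ^ 2 = (1 - ρ) * (1 + r) / ((1 + ρ) * (1 - r)) := by
    rw [hβ, div_pow, hα, hA, hs]
    field_simp
    ring
  have hβ1 : β < 1 := by
    have : 0 < 1 - β ^ 2 := by rw [hβsq]; positivity
    nlinarith
  have hα1 : α < 1 := by nlinarith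
  have hT : Measurable fun t : (ℝ × ℝ) × ℝ =>
      ((A * t.1.1 + b * t.2, A * t.1.1 - b * t.2), t.1.2) := by fun_prop
  have hprob : IsProbabilityMeasure (((stdGaussianPair β).prod (gaussianReal 0 1)).map
      fun t => ((A * t.1.1 + b * t.2, A * t.1.1 - b * t.2), t.1.2)) :=
    Measure.isProbabilityMeasure_map hT.aemeasurable
  have hpair : ∀ e : ℝ, e ^ 2 = b ^ 2 → ((stdGaussianPair β).prod (gaussianReal 0 1)).map
      (fun t => (A * t.1.1 + e * t.2, t.1.2)) = stdGaussianPair α := by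
    intro e he
    have hm : Measurable fun t : (ℝ × ℝ) × ℝ => (A * t.1.1 + e * t.2, t.1.2) := by fun_prop
    have := Measure.isProbabilityMeasure_map hm.aemeasurable
      (μ := (stdGaussianPair β).prod (gaussianReal 0 1))
    refine ext_of_map_linearCombination fun c d => ?_
    rw [Measure.map_map (by fun_prop) hm,
      map_linearCombination_stdGaussianPair (by linarith) hα1.le]
    have h := map_linearCombination_stdGaussianPair_prod (by linarith) hβ1.le (c * A) d (c * e)
    convert h using 2
    · ext t
      simp only [Function.comp_apply]
      ring
    · congr 1
      rw [← hAβ]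
      linear_combination (-c ^ 2) * hA - c ^ 2 * hb - c ^ 2 * he
  have hXY : (((stdGaussianPair β).prod (gaussianReal 0 1)).map
      fun t => ((A * t.1.1 + b * t.2, A * t.1.1 - b * t.2), t.1.2)).map Prod.fst
      = stdGaussianPair ρ := by
    have hm : Measurable fun t : (ℝ × ℝ) × ℝ =>
      (A * t.1.1 + b * t.2, A * t.1.1 - b * t.2) := by fun_prop
    have := Measure.isProbabilityMeasure_map hm.aemeasurable
      (μ := (stdGaussianPair β).prod (gaussianReal 0 1))
    rw [Measure.map_map measurable_fst hT]
    change Measure.map (fun t : (ℝ × ℝ) × ℝ =>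
      (A * t.1.1 + b * t.2, A * t.1.1 - b * t.2)) _ = _
    refine ext_of_map_linearCombination fun c d => ?_
    rw [Measure.map_map (by fun_prop) hm,
      map_linearCombination_stdGaussianPair (by linarith) hρ1.le]
    have h := map_linearCombination_stdGaussianPair_prod (by linarith) hβ1.le
      ((c + d) * A) 0 ((c - d) * b)
    convert h using 2
    · ext t
      simp only [Function.comp_apply]
      ring
    · congr 1
      linear_combination (-(c + d) ^ 2) * hA - (c - d) ^ 2 * hb
  have hXW : (((stdGaussianPair β).prod (gaussianReal 0 1)).map
      fun t => ((A * t.1.1 + b * t.2, A * t.1.1 - b * t.2), t.1.2)).map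
      (fun p => (p.1.1, p.2)) = stdGaussianPair α := by
    rw [Measure.map_map (by fun_prop) hT]
    exact hpair b rfl
  have hYW : (((stdGaussianPair β).prod (gaussianReal 0 1)).map
      fun t => ((A * t.1.1 + b * t.2, A * t.1.1 - b * t.2), t.1.2)).map
      (fun p => (p.1.2, p.2)) = stdGaussianPair α := by
    rw [Measure.map_map (by fun_prop) hT, ← hpair (-b) (by ring)]
    congr 1
    ext t <;> simp [sub_eq_add_neg]
  have hle : mutInfo (((stdGaussianPair β).prod (gaussianReal 0 1)).map
      fun t => ((A * t.1.1 + b * t.2, A * t.1.1 - b * t.2), t.1.2)) ≤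
      ENNReal.ofReal (1 / 2 * Real.log ((1 + ρ) * (1 - r) / ((1 - ρ) * (1 + r)))) := by
    refine (mutInfo_map_noise_le (stdGaussianPair β) (gaussianReal 0 1)
      (h := fun q : ℝ × ℝ => (A * q.1 + b * q.2, A * q.1 - b * q.2)) (by fun_prop)).trans
      (le_of_eq ?_)
    rw [mutInfo_stdGaussianPair (by linarith) hβ1, hβsq,
      ← inv_div ((1 + ρ) * (1 - r)), Real.log_inv]
    congr 1
    ring
  refine ⟨_, hprob, hXY, ?_, hle⟩
  have hchain := mutInfo_chain (((stdGaussianPair β).prod (gaussianReal 0 1)).map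
      fun t => ((A * t.1.1 + b * t.2, A * t.1.1 - b * t.2), t.1.2))
  rw [hXY, hYW, mutInfo_stdGaussianPair (by linarith) hρ1,
    mutInfo_stdGaussianPair (by linarith) hα1] at hchain
  rw [hXW, mutInfo_stdGaussianPair (by linarith) hα1]
  refine (ENNReal.add_le_add_iff_left
    (a := ENNReal.ofReal (-(1 / 2) * Real.log (1 - α ^ 2))) ENNReal.ofReal_ne_top).1 ?_
  rw [← hchain]
  refine (add_le_add_right hle _).trans (le_of_eq ?_)
  have n1 := log_one_sub_sq_nonpos (by linarith : -1 < ρ) hρ1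
  have n2 := log_one_sub_sq_nonpos (by linarith : -1 < α) hα1
  have n3 := log_one_sub_sq_nonpos (by linarith : -1 < r) (by linarith)
  have n4 : 0 ≤ Real.log ((1 + ρ) * (1 - r) / ((1 - ρ) * (1 + r))) := by
    refine Real.log_nonneg ?_
    rw [one_le_div (by positivity)]
    nlinarith
  rw [hγ, ← ENNReal.ofReal_add (by linarith) (by linarith),
    ← ENNReal.ofReal_add (by linarith) (by linarith),
    ← ENNReal.ofReal_add (by linarith) (by linarith)]
  congr 1
  have e1 : 1 - ρ ^ 2 = (1 - ρ) * (1 + ρ) := by ring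
  have e2 : 1 - α ^ 2 = (1 - ρ) / (1 - r) := by rw [hα, hs]; ring
  have e3 : 1 - r ^ 2 = (1 - r) * (1 + r) := by ring
  rw [e1, e2, e3, Real.log_div (by positivity) (by positivity),
    Real.log_mul hρ1'.ne' hρ0.ne', Real.log_mul hρ0.ne' hr1.ne', Real.log_mul hρ1'.ne' hr0'.ne',
    Real.log_mul hr1.ne' hr0'.ne', Real.log_div hρ1'.ne' hr1.ne']
  ring

end Achievability

section Reduction

lemma isProbabilityMeasure_map_equiv {E F G H : Type*} [MeasurableSpace E] [MeasurableSpace F]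
    [MeasurableSpace G] [MeasurableSpace H] (ν : Measure (E × F)) [IsProbabilityMeasure ν]
    (e : E ≃ᵐ G) (f : F ≃ᵐ H) : IsProbabilityMeasure (ν.map (Prod.map e f)) :=
  Measure.isProbabilityMeasure_map (e.measurable.prodMap f.measurable).aemeasurable

lemma exists_map_prodCongr {E F G E' F' : Type*} [MeasurableSpace E] [MeasurableSpace F]
    [MeasurableSpace G] [MeasurableSpace E'] [MeasurableSpace F'] (e : E ≃ᵐ E') (f : F ≃ᵐ F')
    (ν : Measure ((E × F) × G)) [IsProbabilityMeasure ν] {δ : ℝ≥0∞}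
    (hcon : mutInfo (ν.map fun p => (p.1.1, (p.1.2, p.2))) ≤
      mutInfo (ν.map fun p => (p.1.1, p.2)) + δ) :
    ∃ ν' : Measure ((E' × F') × G), ∃ _ : IsProbabilityMeasure ν',
      ν'.map Prod.fst = (ν.map Prod.fst).map (Prod.map e f) ∧
      mutInfo (ν'.map fun p => (p.1.1, (p.1.2, p.2))) ≤
        mutInfo (ν'.map fun p => (p.1.1, p.2)) + δ ∧ mutInfo ν' = mutInfo ν := by
  have hm1 : Measurable fun p : (E × F) × G => (p.1.1, (p.1.2, p.2)) := by fun_prop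
  have hm2 : Measurable fun p : (E × F) × G => (p.1.1, p.2) := by fun_prop
  have hm1' : Measurable fun p : (E' × F') × G => (p.1.1, (p.1.2, p.2)) := by fun_prop
  have hm2' : Measurable fun p : (E' × F') × G => (p.1.1, p.2) := by fun_prop
  have hp1 := Measure.isProbabilityMeasure_map (μ := ν) hm1.aemeasurable
  have hp2 := Measure.isProbabilityMeasure_map (μ := ν) hm2.aemeasurable
  let id' := MeasurableEquiv.refl G
  have hg := ((e.prodCongr f).measurable.prodMap id'.measurable)
  have h1 := mutInfo_map_measurableEquiv (ν.map fun p => (p.1.1, (p.1.2, p.2)))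
    e (f.prodCongr id')
  have h2 := mutInfo_map_measurableEquiv (ν.map fun p => (p.1.1, p.2)) e id'
  rw [Measure.map_map (e.measurable.prodMap (f.prodCongr id').measurable) hm1] at h1
  rw [Measure.map_map (e.measurable.prodMap id'.measurable) hm2] at h2
  refine ⟨ν.map (Prod.map (e.prodCongr f) id'), isProbabilityMeasure_map_equiv _ _ _, ?_, ?_,
    mutInfo_map_measurableEquiv ν (e.prodCongr f) id'⟩
  · rw [Measure.map_map measurable_fst hg,
      Measure.map_map (e.measurable.prodMap f.measurable) measurable_fst]
    rfl
  · rw [Measure.map_map hm1' hg, Measure.map_map hm2' hg]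
    calc _ = _ := h1
      _ ≤ _ := hcon
      _ = _ := by rw [← h2]; rfl

variable {Ω : Type*} [MeasurableSpace Ω] {μ : Measure Ω}

lemma memLp_two_of_map_eq_gaussianReal {Z : Ω → ℝ} (hZ : Measurable Z) {m : ℝ} {v : ℝ≥0}
    (h : μ.map Z = gaussianReal m v) : MemLp Z 2 μ := by
  have := memLp_id_gaussianReal (μ := m) (v := v) 2
  rw [← h] at this
  exact (memLp_map_measure_iff aestronglyMeasurable_id hZ.aemeasurable).1 this

lemma map_standardize_eq_stdGaussianPair [IsProbabilityMeasure μ] {X Y : Ω → ℝ}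
    (hX : Measurable X) (hY : Measurable Y)
    (hGauss : ∀ a b : ℝ, ∃ (m : ℝ) (v : ℝ≥0),
      μ.map (fun ω => a * X ω + b * Y ω) = gaussianReal m v)
    {mx my sx sy ρ : ℝ} (hmx : mx = ∫ ω, X ω ∂μ) (hmy : my = ∫ ω, Y ω ∂μ)
    (hsx : sx ≠ 0) (hsy : sy ≠ 0) (hvx : ∫ ω, (X ω - mx) ^ 2 ∂μ = sx ^ 2)
    (hvy : ∫ ω, (Y ω - my) ^ 2 ∂μ = sy ^ 2)
    (hcov : ∫ ω, (X ω - mx) * (Y ω - my) ∂μ = ρ * (sx * sy)) (h0 : -1 ≤ ρ) (h1 : ρ ≤ 1) :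
    μ.map (fun ω => ((X ω + -mx) * sx⁻¹, (Y ω + -my) * sy⁻¹)) = stdGaussianPair ρ := by
  have hm : Measurable fun ω => ((X ω + -mx) * sx⁻¹, (Y ω + -my) * sy⁻¹) := by fun_prop
  have hXL : MemLp X 2 μ := by
    obtain ⟨m, v, h⟩ := hGauss 1 0
    simp only [one_mul, zero_mul, add_zero] at h
    exact memLp_two_of_map_eq_gaussianReal hX h
  have hYL : MemLp Y 2 μ := by
    obtain ⟨m, v, h⟩ := hGauss 0 1
    simp only [one_mul, zero_mul, zero_add] at h
    exact memLp_two_of_map_eq_gaussianReal hY h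
  have hX2 : MemLp (fun ω => X ω - mx) 2 μ := hXL.sub (memLp_const mx)
  have hY2 : MemLp (fun ω => Y ω - my) 2 μ := hYL.sub (memLp_const my)
  have hXY : Integrable (fun ω => (X ω - mx) * (Y ω - my)) μ := hX2.integrable_mul hY2
  have hXi := hX2.integrable (by norm_num)
  have hYi := hY2.integrable (by norm_num)
  have hXm : ∫ ω, (X ω - mx) ∂μ = 0 := by
    rw [integral_sub (hXL.integrable (by norm_num)) (integrable_const _)]
    simp [hmx]
  have hYm : ∫ ω, (Y ω - my) ∂μ = 0 := by
    rw [integral_sub (hYL.integrable (by norm_num)) (integrable_const _)]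
    simp [hmy]
  have := Measure.isProbabilityMeasure_map (μ := μ) hm.aemeasurable
  refine ext_of_map_linearCombination fun c d => ?_
  rw [Measure.map_map (by fun_prop) hm, map_linearCombination_stdGaussianPair h0 h1]
  obtain ⟨m, v, h⟩ := hGauss (c * sx⁻¹) (d * sy⁻¹)
  have hlin : (μ.map fun ω => c * sx⁻¹ * (X ω - mx) + d * sy⁻¹ * (Y ω - my)) =
      gaussianReal (m + -(c * sx⁻¹ * mx + d * sy⁻¹ * my)) v := by
    rw [← gaussianReal_map_add_const, ← h, Measure.map_map (by fun_prop) (by fun_prop)]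
    congr 1
    ext ω
    simp only [Function.comp_apply]
    ring
  have hmeas : AEMeasurable (fun ω => c * sx⁻¹ * (X ω - mx) + d * sy⁻¹ * (Y ω - my)) μ := by
    fun_prop
  have hmean : m + -(c * sx⁻¹ * mx + d * sy⁻¹ * my) = 0 := by
    rw [← integral_id_gaussianReal (μ := m + -(c * sx⁻¹ * mx + d * sy⁻¹ * my)) (v := v), ← hlin,
      integral_map hmeas (by fun_prop),
      integral_add (hXi.const_mul _) (hYi.const_mul _), integral_const_mul, integral_const_mul,
      hXm, hYm]
    simp
  rw [hmean] at hlin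
  have hvar : (v : ℝ) = c ^ 2 + d ^ 2 + 2 * c * d * ρ := by
    rw [← integral_sq_gaussianReal v, ← hlin, integral_map hmeas (by fun_prop)]
    have hexp : ∀ ω, (c * sx⁻¹ * (X ω - mx) + d * sy⁻¹ * (Y ω - my)) ^ 2 =
        (c * sx⁻¹) ^ 2 * (X ω - mx) ^ 2 + (d * sy⁻¹) ^ 2 * (Y ω - my) ^ 2 +
        2 * (c * sx⁻¹) * (d * sy⁻¹) * ((X ω - mx) * (Y ω - my)) := fun ω => by ring
    simp_rw [hexp]
    rw [integral_add, integral_add (hX2.integrable_sq.const_mul _) (hY2.integrable_sq.const_mul _),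
      integral_const_mul, integral_const_mul, integral_const_mul, hvx, hvy, hcov]
    · field_simp
    · exact (hX2.integrable_sq.const_mul _).add (hY2.integrable_sq.const_mul _)
    · exact hXY.const_mul _
  rw [← hvar, Real.toNNReal_coe, ← hlin]
  congr 1
  ext ω
  simp only [Function.comp_apply]
  ring

end Reduction

section Characterization

lemma miE_constraint_iff (ν : Measure ((ℝ × ℝ) × ℝ)) [IsProbabilityMeasure ν] {γ : ℝ}
    (hγ : 0 ≤ γ) :
    miE (ν.map fun p => (p.1.1, (p.1.2, p.2))) ≤ miE (ν.map fun p => (p.1.1, p.2)) + (γ : EReal) ↔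
      mutInfo (ν.map fun p => (p.1.1, (p.1.2, p.2))) ≤
        mutInfo (ν.map fun p => (p.1.1, p.2)) + ENNReal.ofReal γ := by
  have hm1 : Measurable fun p : (ℝ × ℝ) × ℝ => (p.1.1, (p.1.2, p.2)) := by fun_prop
  have hm2 : Measurable fun p : (ℝ × ℝ) × ℝ => (p.1.1, p.2) := by fun_prop
  have := Measure.isProbabilityMeasure_map (μ := ν) hm1.aemeasurable
  have := Measure.isProbabilityMeasure_map (μ := ν) hm2.aemeasurable
  have hγ' : (γ : EReal) = ((ENNReal.ofReal γ : ℝ≥0∞) : EReal) := by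
    rw [EReal.coe_ennreal_ofReal, max_eq_left hγ]
  rw [miE_eq_mutInfo, miE_eq_mutInfo, hγ', ← EReal.coe_ennreal_add,
    EReal.coe_ennreal_le_coe_ennreal_iff]

lemma exists_mutInfo_eq_max_log_ratio {ρ γ : ℝ} (hρ0 : 0 ≤ ρ) (hρ1 : ρ < 1) (hγ : 0 ≤ γ) :
    ∃ ν : Measure ((ℝ × ℝ) × ℝ), ∃ _ : IsProbabilityMeasure ν,
      ν.map Prod.fst = stdGaussianPair ρ ∧
      mutInfo (ν.map fun p => (p.1.1, (p.1.2, p.2))) ≤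
        mutInfo (ν.map fun p => (p.1.1, p.2)) + ENNReal.ofReal γ ∧
      mutInfo ν = ENNReal.ofReal (1 / 2 * max (Real.log
        ((1 + ρ) * (1 - √(1 - Real.exp (-2 * γ))) /
          ((1 - ρ) * (1 + √(1 - Real.exp (-2 * γ)))))) 0) := by
  have hexp : Real.exp (-2 * γ) ≤ 1 := Real.exp_le_one_iff.2 (by linarith)
  have hr0 := Real.sqrt_nonneg (1 - Real.exp (-2 * γ))
  have hr := Real.sq_sqrt (sub_nonneg.2 hexp)
  set r := √(1 - Real.exp (-2 * γ))
  have hr1 : r < 1 := by nlinarith [Real.exp_pos (-2 * γ)]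
  have hγr : γ = -(1 / 2) * Real.log (1 - r ^ 2) := by
    rw [hr, sub_sub_cancel, Real.log_exp]
    ring
  have hr0' : 0 < 1 + r := by linarith
  have hρ1' : 0 < 1 - ρ := by linarith
  rcases le_or_gt ρ r with h | h
  · obtain ⟨ν, hν, hfst, hcon, hval⟩ := exists_mutInfo_eq_zero hρ0 hρ1 h hr1 hγr
    refine ⟨ν, hν, hfst, hcon, ?_⟩
    have hlog : Real.log ((1 + ρ) * (1 - r) / ((1 - ρ) * (1 + r))) ≤ 0 := by
      refine Real.log_nonpos ?_ ?_
      · exact div_nonneg (mul_nonneg (by linarith) (by linarith)) (by positivity)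
      · rw [div_le_one (by positivity)]
        nlinarith
    rw [hval, max_eq_right hlog]
    simp
  · obtain ⟨ν, hν, hfst, hcon, hval⟩ := exists_mutInfo_le hr0 h hρ1 hγr
    have hlog : 0 ≤ Real.log ((1 + ρ) * (1 - r) / ((1 - ρ) * (1 + r))) := by
      refine Real.log_nonneg ?_
      rw [one_le_div (by positivity)]
      nlinarith
    have hfin : mutInfo ν ≠ ∞ := ne_top_of_le_ne_top ENNReal.ofReal_ne_top hval
    refine ⟨ν, hν, hfst, hcon, ?_⟩
    rw [max_eq_left hlog]
    refine le_antisymm hval ?_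
    rw [← ENNReal.ofReal_toReal hfin]
    refine ENNReal.ofReal_le_ofReal ?_
    have := max_log_ratio_le_mutInfo hρ0 hρ1 hγ hfst hfin hcon
    rwa [max_eq_left hlog] at this

end Characterization

end

/-- For jointly Gaussian scalar `X, Y` with correlation coefficient
`ρ ∈ [0,1)` and any `γ ≥ 0`, the relaxed Wyner's common information (infimum of `I(X,Y;W)`
over all `W` with `I(X;Y|W) ≤ γ`, the conditional mutual information being expressed via the
chain rule as `I(X;(Y,W)) − I(X;W)`) equals
`½ log⁺[(1+ρ)(1−√(1−e^{−2γ})) / ((1−ρ)(1+√(1−e^{−2γ})))]`, where `log⁺ t = max{log t, 0}`. -/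
theorem relaxedWynerCI_gaussian_scalar
    {Ω : Type*} [MeasurableSpace Ω] (μ : Measure Ω) [IsProbabilityMeasure μ]
    (X Y : Ω → ℝ) (hX : Measurable X) (hY : Measurable Y)
    -- `X` and `Y` are jointly Gaussian: every linear combination is Gaussian
    (hGauss : ∀ a b : ℝ, ∃ (m : ℝ) (v : ℝ≥0),
      μ.map (fun ω => a * X ω + b * Y ω) = gaussianReal m v)
    -- nondegenerate variances
    (hVarX : 0 < ∫ ω, (X ω - ∫ x, X x ∂μ) ^ 2 ∂μ)
    (hVarY : 0 < ∫ ω, (Y ω - ∫ x, Y x ∂μ) ^ 2 ∂μ)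
    -- `ρ` is the correlation coefficient of `X` and `Y`
    (ρ : ℝ)
    (hρ : ρ = (∫ ω, (X ω - ∫ x, X x ∂μ) * (Y ω - ∫ x, Y x ∂μ) ∂μ) /
      Real.sqrt ((∫ ω, (X ω - ∫ x, X x ∂μ) ^ 2 ∂μ) * (∫ ω, (Y ω - ∫ x, Y x ∂μ) ^ 2 ∂μ)))
    (hρ0 : 0 ≤ ρ) (hρ1 : ρ < 1)
    (γ : ℝ) (hγ : 0 ≤ γ) :
    sInf { c : ℝ |
      ∃ ν : Measure ((ℝ × ℝ) × ℝ), ∃ _ : IsProbabilityMeasure ν,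
        -- `ν` is the joint law of `((X,Y), W)`; its `(X,Y)`-marginal is the law of `(X,Y)`
        ν.map Prod.fst = μ.map (fun ω => (X ω, Y ω)) ∧
        -- `I(X;Y|W) ≤ γ`, i.e. (chain rule) `I(X;(Y,W)) ≤ I(X;W) + γ`
        miE (ν.map fun p => (p.1.1, (p.1.2, p.2))) ≤
          miE (ν.map fun p => (p.1.1, p.2)) + (γ : EReal) ∧
        -- `c = I(X,Y;W)`
        miE ν = (c : EReal) } =
      1 / 2 * max (Real.log ((1 + ρ) * (1 - Real.sqrt (1 - Real.exp (-2 * γ))) /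
        ((1 - ρ) * (1 + Real.sqrt (1 - Real.exp (-2 * γ)))))) 0 := by
  set mx := ∫ x, X x ∂μ with hmx
  set my := ∫ x, Y x ∂μ with hmy
  set vx := ∫ ω, (X ω - mx) ^ 2 ∂μ with hvx
  set vy := ∫ ω, (Y ω - my) ^ 2 ∂μ with hvy
  set r := Real.sqrt (1 - Real.exp (-2 * γ)) with hr
  have hsx : √vx ≠ 0 := (Real.sqrt_pos.2 hVarX).ne'
  have hsy : √vy ≠ 0 := (Real.sqrt_pos.2 hVarY).ne'
  let e : ℝ ≃ᵐ ℝ :=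
    (MeasurableEquiv.addRight (-mx)).trans (MeasurableEquiv.mulRight₀ (√vx)⁻¹ (inv_ne_zero hsx))
  let f : ℝ ≃ᵐ ℝ :=
    (MeasurableEquiv.addRight (-my)).trans (MeasurableEquiv.mulRight₀ (√vy)⁻¹ (inv_ne_zero hsy))
  have hXY : Measurable fun ω => (X ω, Y ω) := hX.prodMk hY
  have hstd : (μ.map fun ω => (X ω, Y ω)).map (Prod.map e f) = stdGaussianPair ρ := by
    rw [Measure.map_map (e.measurable.prodMap f.measurable) hXY]
    refine map_standardize_eq_stdGaussianPair hX hY hGauss hmx hmy hsx hsy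
      (Real.sq_sqrt hVarX.le).symm (Real.sq_sqrt hVarY.le).symm ?_ (by linarith) hρ1.le
    rw [hρ, Real.sqrt_mul hVarX.le, div_mul_cancel₀ _ (mul_ne_zero hsx hsy)]
  have hstd' : (stdGaussianPair ρ).map (Prod.map e.symm f.symm) = μ.map fun ω => (X ω, Y ω) := by
    rw [← hstd, Measure.map_map (e.symm.measurable.prodMap f.symm.measurable)
      (e.measurable.prodMap f.measurable)]
    have hid : Prod.map e.symm f.symm ∘ Prod.map e f = id := by ext x <;> simp
    rw [hid, Measure.map_id]
  refine IsLeast.csInf_eq ⟨?_, ?_⟩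
  · obtain ⟨ν₀, _, hν₀, hcon₀, hval₀⟩ := exists_mutInfo_eq_max_log_ratio hρ0 hρ1 hγ
    obtain ⟨ν, hν, hfst, hcon, hval⟩ := exists_map_prodCongr e.symm f.symm ν₀ hcon₀
    refine ⟨ν, hν, by rw [hfst, hν₀, hstd'], (miE_constraint_iff ν hγ).2 hcon, ?_⟩
    rw [miE_eq_mutInfo, hval, hval₀, EReal.coe_ennreal_ofReal,
      max_eq_left (mul_nonneg (by norm_num) (le_max_right _ _))]
  · rintro c ⟨ν, hν, hfst, hcon, hc⟩
    obtain ⟨ν', hν', hfst', hcon', hval⟩ :=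
      exists_map_prodCongr e f ν ((miE_constraint_iff ν hγ).1 hcon)
    rw [hfst, hstd] at hfst'
    rw [miE_eq_mutInfo, ← hval] at hc
    have hfin : mutInfo ν' ≠ ∞ := by
      intro h
      rw [h, EReal.coe_ennreal_top] at hc
      exact EReal.top_ne_coe c hc
    have := max_log_ratio_le_mutInfo hρ0 hρ1 hγ hfst' hfin hcon'
    rwa [← EReal.toReal_coe_ennreal, hc, EReal.toReal_coe] at this
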